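/- Let Ω ⊂ ℝ^m be a bounded open set with smooth boundary, let α ∈ (0,1) and let t_1, t_2 be real numbers with 0 ≤ t_1 < t_2. Then there exists a constant C > 0 such that for every f ∈ C̃^{α t_2 + (1−α) t_1}(cl Ω) one has sup_{s>0} s^{−α} K(s, f; C̃^{t_1}(cl Ω), C̃^{t_2}(cl Ω)) ≤ C ‖f‖_{C^{α t_2 + (1−α) t_1}(cl Ω)}; that is, C̃^{α t_2 + (1−α) t_1}(cl Ω) ⊂ (C̃^{t_1}(cl Ω), C̃^{t_2}(cl Ω))_{α,∞} continuously. -/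

import Mathlib

open Set

noncomputable section

/-- `Ω` has smooth boundary: near every boundary point, `Ω` is the sublevel set of a smooth
function with non-vanishing differential. -/
def HasSmoothBoundary {E : Type*} [NormedAddCommGroup E] [NormedSpace ℝ E] (Ω : Set E) : Prop :=
  ∀ x ∈ frontier Ω, ∃ (U : Set E) (φ : E → ℝ), IsOpen U ∧ x ∈ U ∧ ContDiff ℝ (⊤ : ℕ∞) φ ∧
    (∀ y ∈ U, fderiv ℝ φ y ≠ 0) ∧ Ω ∩ U = {y ∈ U | φ y < 0}

/-- `f` belongs to `C^t(s)`: it is `C^⌊t⌋` on `s`, with bounded derivatives of order `≤ ⌊t⌋`,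
and the order-`⌊t⌋` derivative is `(t - ⌊t⌋)`-Hölder continuous on `s`. -/
def MemCt {E : Type*} [NormedAddCommGroup E] [NormedSpace ℝ E]
    (t : ℝ) (s : Set E) (f : E → ℝ) : Prop :=
  ContDiffOn ℝ (⌊t⌋₊ : ℕ) f s ∧
  (∃ C : ℝ, ∀ i : ℕ, (i : ℝ) ≤ t → ∀ x ∈ s, ‖iteratedFDerivWithin ℝ i f s x‖ ≤ C) ∧
  (∃ C : ℝ, ∀ x ∈ s, ∀ y ∈ s,
    ‖iteratedFDerivWithin ℝ ⌊t⌋₊ f s x - iteratedFDerivWithin ℝ ⌊t⌋₊ f s y‖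
      ≤ C * ‖x - y‖ ^ (t - (⌊t⌋₊ : ℝ)))

/-- The `C^t` norm on a set `s`. -/
def ctNorm {E : Type*} [NormedAddCommGroup E] [NormedSpace ℝ E]
    (t : ℝ) (s : Set E) (f : E → ℝ) : ℝ :=
  max (sSup {r : ℝ | ∃ i : ℕ, (i : ℝ) ≤ t ∧ ∃ x ∈ s, r = ‖iteratedFDerivWithin ℝ i f s x‖})
      (sSup {r : ℝ | ∃ x ∈ s, ∃ y ∈ s, x ≠ y ∧
        r = ‖iteratedFDerivWithin ℝ ⌊t⌋₊ f s x - iteratedFDerivWithin ℝ ⌊t⌋₊ f s y‖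
              / ‖x - y‖ ^ (t - (⌊t⌋₊ : ℝ))})

/-- `f ∈ C̃^t(cl Ω)`: `f ∈ C^t(cl Ω)` and `f` vanishes on `∂Ω`. -/
def MemCtTilde {E : Type*} [NormedAddCommGroup E] [NormedSpace ℝ E]
    (t : ℝ) (Ω : Set E) (f : E → ℝ) : Prop :=
  MemCt t (closure Ω) f ∧ ∀ x ∈ frontier Ω, f x = 0

/-- The K-functional `K(s, f; C̃^{t₀}(cl Ω), C̃^{t₁}(cl Ω))`. -/
def kFunctional {E : Type*} [NormedAddCommGroup E] [NormedSpace ℝ E]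
    (s : ℝ) (t₀ t₁ : ℝ) (Ω : Set E) (f : E → ℝ) : ℝ :=
  sInf {r : ℝ | ∃ f₀ f₁ : E → ℝ, (∀ x ∈ closure Ω, f x = f₀ x + f₁ x) ∧
    MemCtTilde t₀ Ω f₀ ∧ MemCtTilde t₁ Ω f₁ ∧
    r = ctNorm t₀ (closure Ω) f₀ + s * ctNorm t₁ (closure Ω) f₁}

section Auxiliary

open MeasureTheory Filter Topology
open scoped ContDiff

set_option linter.unusedSectionVars false

section FiniteDifferences

variable {E F : Type} [NormedAddCommGroup E] [NormedSpace ℝ E]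
  [NormedAddCommGroup F] [NormedSpace ℝ F]

/-- There are coefficients, normalized by `c 0 = 1`, annihilating all polynomials of degree at
most `k`. -/
theorem exists_moment_coefficients (k : ℕ) : ∃ c : ℕ → ℝ, c 0 = 1 ∧
    ∀ p ≤ k, ∑ i ∈ Finset.range (k + 2), c i * (i : ℝ) ^ p = 0 := by
  refine ⟨fun i ↦ (-1) ^ i * ((k + 1).choose i : ℝ), by simp, fun p hp ↦ ?_⟩
  have h := congrFun (fwdDiff_iter_pow_eq_zero_of_lt (R := ℝ) (Nat.lt_succ_of_le hp)) 0
  rw [fwdDiff_iter_eq_sum_shift] at h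
  have h2 : (-1 : ℝ) ^ (k + 1) * ∑ i ∈ Finset.range (k + 2),
      ((-1) ^ i * ((k + 1).choose i : ℝ)) * (i : ℝ) ^ p = 0 := by
    rw [← Pi.zero_apply (M := fun _ : ℝ ↦ ℝ) (0 : ℝ), ← h, Finset.mul_sum]
    refine Finset.sum_congr rfl fun i hi ↦ ?_
    have hi' : i ≤ k + 1 := Nat.lt_succ_iff.1 (Finset.mem_range.1 hi)
    obtain ⟨l, hl⟩ := Nat.exists_eq_add_of_le hi'
    have : k + 1 - i = l := by omega
    simp only [zsmul_eq_mul, zero_add, nsmul_eq_mul, mul_one, Nat.succ_eq_add_one, this]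
    rw [hl, pow_add]
    push_cast
    have h1 : ((-1 : ℝ) ^ i) * (-1) ^ i = 1 := by rw [← mul_pow]; simp
    linear_combination ((-1 : ℝ) ^ l * ((i + l).choose i : ℝ) * (i : ℝ) ^ p) * h1
  exact (mul_eq_zero.1 h2).resolve_left (pow_ne_zero _ (by norm_num))

theorem norm_iteratedFDeriv_fderiv_sub (u : E → F) (k : ℕ) (x y : E) :
    ‖iteratedFDeriv ℝ k (fderiv ℝ u) y - iteratedFDeriv ℝ k (fderiv ℝ u) x‖
      = ‖iteratedFDeriv ℝ (k + 1) u y - iteratedFDeriv ℝ (k + 1) u x‖ := by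
  simp only [iteratedFDeriv_succ_eq_comp_right, Function.comp_apply]
  rw [← dist_eq_norm, ← dist_eq_norm]
  exact ((continuousMultilinearCurryRightEquiv' ℝ k E F).symm.isometry.dist_eq _ _).symm

theorem norm_iteratedFDeriv_zero_sub (u : E → F) (x y : E) :
    ‖iteratedFDeriv ℝ 0 u y - iteratedFDeriv ℝ 0 u x‖ = ‖u y - u x‖ := by
  simp only [iteratedFDeriv_zero_eq_comp, Function.comp_apply]
  rw [← map_sub, LinearIsometryEquiv.norm_map]

/-- A combination of values of a `C^{k,θ}` function along a ray with `k + 1` vanishing moments is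
of order `k + θ` in the step. -/
theorem norm_sum_smul_ray_le {F : Type} [NormedAddCommGroup F] [NormedSpace ℝ F] (n : ℕ)
    {θ A : ℝ} (hθ : 0 ≤ θ) (hA0 : 0 ≤ A) (k : ℕ) (u : E → F) (hu : ContDiff ℝ k u) (c : ℕ → ℝ)
    (hc : ∀ p ≤ k, ∑ i ∈ Finset.range (n + 1), c i * (i : ℝ) ^ p = 0) (x w : E)
    (hA : ∀ s ∈ Icc (0 : ℝ) n, ‖iteratedFDeriv ℝ k u (x + s • w) - iteratedFDeriv ℝ k u x‖
      ≤ A * (s * ‖w‖) ^ θ) :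
    ‖∑ i ∈ Finset.range (n + 1), c i • u (x + (i : ℝ) • w)‖
      ≤ (∑ i ∈ Finset.range (n + 1), |c i| * (i : ℝ) ^ k * (i : ℝ) ^ θ)
        * A * ‖w‖ ^ k * ‖w‖ ^ θ := by
  induction k generalizing F c w with
  | zero =>
    have h0 : ∑ i ∈ Finset.range (n + 1), c i = 0 := by simpa using hc 0 le_rfl
    have : ∑ i ∈ Finset.range (n + 1), c i • u (x + (i : ℝ) • w)
        = ∑ i ∈ Finset.range (n + 1), c i • (u (x + (i : ℝ) • w) - u x) := by
      simp only [smul_sub, Finset.sum_sub_distrib, ← Finset.sum_smul, h0, zero_smul, sub_zero]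
    rw [this]
    simp only [Finset.sum_mul]
    refine (norm_sum_le _ _).trans (Finset.sum_le_sum fun i hi ↦ ?_)
    have h1 := hA i ⟨by positivity, by
      exact_mod_cast Nat.lt_succ_iff.1 (Finset.mem_range.1 hi)⟩
    rw [norm_iteratedFDeriv_zero_sub, Real.mul_rpow (by positivity) (by positivity)] at h1
    rw [norm_smul, Real.norm_eq_abs]
    calc |c i| * _ ≤ |c i| * (A * ((i : ℝ) ^ θ * ‖w‖ ^ θ)) := by gcongr
      _ = _ := by ring
  | succ k ih =>
    set K := ∑ i ∈ Finset.range (n + 1), |c i| * (i : ℝ) ^ (k + 1) * (i : ℝ) ^ θ with hK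
    have hK0 : 0 ≤ K := by positivity
    have hd : Differentiable ℝ u := hu.differentiable (by simp)
    let g : ℝ → F := fun σ ↦ ∑ i ∈ Finset.range (n + 1), c i • u (x + (i : ℝ) • (σ • w))
    let g' : ℝ → F := fun σ ↦
      (∑ i ∈ Finset.range (n + 1), (c i * i) • fderiv ℝ u (x + (i : ℝ) • (σ • w))) w
    have hg : ∀ σ, HasDerivAt g (g' σ) σ := by
      intro σ
      simp only [g, g', sum_apply]
      refine HasDerivAt.fun_sum fun i _ ↦ ?_
      have h1 : HasDerivAt (fun σ : ℝ ↦ x + (i : ℝ) • (σ • w)) ((i : ℝ) • w) σ := by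
        simpa using (((hasDerivAt_id σ).smul_const w).const_smul (i : ℝ)).const_add x
      have h2 := ((hd (x + (i : ℝ) • (σ • w))).hasFDerivAt.comp_hasDerivAt σ h1).const_smul (c i)
      simpa [mul_smul, Function.comp_def, Pi.smul_def] using h2
    have hb : ∀ σ ∈ Ico (0 : ℝ) 1, ‖g' σ‖ ≤ K * A * ‖w‖ ^ (k + 1) * ‖w‖ ^ θ := by
      rintro σ ⟨hσ0, hσ1⟩
      have h1 := ih (fderiv ℝ u) (hu.fderiv_right (by norm_cast)) (fun i ↦ c i * i) (fun p hp ↦ by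
        simpa [pow_succ', mul_assoc] using hc (p + 1) (by omega)) (σ • w) (fun s hs ↦ by
          rw [norm_iteratedFDeriv_fderiv_sub, smul_smul, norm_smul, ← mul_assoc, Real.norm_eq_abs,
            abs_of_nonneg hσ0]
          exact hA (s * σ) ⟨mul_nonneg hs.1 hσ0, by nlinarith [hs.1, hs.2]⟩)
      have hKK : ∑ i ∈ Finset.range (n + 1), |c i * i| * (i : ℝ) ^ k * (i : ℝ) ^ θ = K := by
        refine Finset.sum_congr rfl fun i _ ↦ ?_
        rw [abs_mul, Nat.abs_cast, pow_succ]; ring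
      rw [hKK] at h1
      have hle : ‖σ • w‖ ≤ ‖w‖ := by
        rw [norm_smul, Real.norm_eq_abs, abs_of_nonneg hσ0]
        nlinarith [norm_nonneg w]
      calc ‖g' σ‖ ≤ (K * A * ‖σ • w‖ ^ k * ‖σ • w‖ ^ θ) * ‖w‖ :=
            (ContinuousLinearMap.le_opNorm _ _).trans (by gcongr)
        _ ≤ (K * A * ‖w‖ ^ k * ‖w‖ ^ θ) * ‖w‖ := by gcongr
        _ = _ := by ring
    have h0 : g 0 = 0 := by
      simp only [g, zero_smul, smul_zero, add_zero, ← Finset.sum_smul]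
      have := hc 0 (Nat.zero_le _)
      simp only [pow_zero, mul_one] at this
      rw [this, zero_smul]
    have := norm_image_sub_le_of_norm_deriv_le_segment_01'
      (fun σ _ ↦ (hg σ).hasDerivWithinAt) hb
    simpa [g, h0] using this

end FiniteDifferences

section Mollifier

variable {E F : Type} [NormedAddCommGroup E] [NormedSpace ℝ E]
  [NormedAddCommGroup F] [NormedSpace ℝ F]
  [FiniteDimensional ℝ E] [MeasureSpace E] [BorelSpace E] [(volume : Measure E).IsAddHaarMeasure]

/-- The average of `u` over the points `x + r • z`, with weight `ζ z`. -/
def mollify (ζ : E → ℝ) (r : ℝ) (u : E → F) (x : E) : F := ∫ z, ζ z • u (x + r • z)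

theorem integrable_mollify {ζ : E → ℝ} (hζ : Continuous ζ) (hζc : HasCompactSupport ζ) (r : ℝ)
    {u : E → F} (hu : Continuous u) (x : E) : Integrable fun z ↦ ζ z • u (x + r • z) :=
  (hζ.smul (hu.comp (by fun_prop))).integrable_of_hasCompactSupport hζc.smul_right

theorem hasFDerivAt_mollify {ζ : E → ℝ} (hζ : Continuous ζ) (hζc : HasCompactSupport ζ) (r : ℝ)
    {u : E → F} (hu : ContDiff ℝ 1 u) (huc : HasCompactSupport u) (x : E) :
    HasFDerivAt (mollify ζ r u) (mollify ζ r (fderiv ℝ u) x) x := by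
  have hcont : Continuous (fderiv ℝ u) := hu.continuous_fderiv (by simp)
  obtain ⟨C, hC⟩ := (huc.fderiv (𝕜 := ℝ)).exists_bound_of_continuous hcont
  refine hasFDerivAt_integral_of_dominated_of_fderiv_le (s := univ)
    (F := fun x z ↦ ζ z • u (x + r • z)) (F' := fun x z ↦ ζ z • fderiv ℝ u (x + r • z))
    (bound := fun z ↦ ‖ζ z‖ * C) univ_mem
    (Eventually.of_forall fun y ↦ (integrable_mollify hζ hζc r hu.continuous y).1)
    (integrable_mollify hζ hζc r hu.continuous x) (integrable_mollify hζ hζc r hcont x).1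
    (Eventually.of_forall fun z y _ ↦ ?_)
    ((hζ.integrable_of_hasCompactSupport hζc).norm.mul_const C)
    (Eventually.of_forall fun z y _ ↦ ?_)
  · rw [norm_smul]
    gcongr
    exact hC _
  · have h1 : HasFDerivAt (fun y : E ↦ y + r • z) (ContinuousLinearMap.id ℝ E) y :=
      (hasFDerivAt_id y).add_const _
    have h2 := ((hu.differentiable (by simp) (y + r • z)).hasFDerivAt.comp y h1).const_smul (ζ z)
    simpa [Function.comp_def, Pi.smul_def] using h2

theorem fderiv_mollify {ζ : E → ℝ} (hζ : Continuous ζ) (hζc : HasCompactSupport ζ) (r : ℝ)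
    {u : E → F} (hu : ContDiff ℝ 1 u) (huc : HasCompactSupport u) :
    fderiv ℝ (mollify ζ r u) = mollify ζ r (fderiv ℝ u) :=
  funext fun x ↦ (hasFDerivAt_mollify hζ hζc r hu huc x).fderiv

theorem norm_convolution_le_of_bound {G H : Type} [NormedAddCommGroup G] [NormedSpace ℝ G]
    [NormedAddCommGroup H] [NormedSpace ℝ H] {g : E → G} (hg : Continuous g)
    (hgc : HasCompactSupport g) (v : E → F) (L : F →L[ℝ] G →L[ℝ] H) (x : E) {B : ℝ}
    (hB : ∀ t ∈ tsupport g, ‖v (x - t)‖ ≤ B) :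
    ‖convolution v g L volume x‖ ≤ ‖L‖ * B * ∫ t, ‖g t‖ := by
  rw [convolution_eq_swap, ← integral_const_mul]
  refine norm_integral_le_of_norm_le
    ((hg.integrable_of_hasCompactSupport hgc).norm.const_mul _) (Eventually.of_forall fun t ↦ ?_)
  by_cases ht : g t = 0
  · simp [ht]
  · refine (L.le_opNorm₂ _ _).trans ?_
    gcongr
    exact hB t (subset_tsupport _ ht)

theorem norm_iteratedFDeriv_convolution_le {G H : Type} [NormedAddCommGroup G]
    [NormedSpace ℝ G] [NormedAddCommGroup H] [NormedSpace ℝ H] (l : ℕ) {g : E → G}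
    (hg : ContDiff ℝ ∞ g) (hgc : HasCompactSupport g) {v : E → F} (hv : LocallyIntegrable v)
    (L : F →L[ℝ] G →L[ℝ] H) (x : E) {B : ℝ} (hB0 : 0 ≤ B)
    (hB : ∀ t ∈ tsupport g, ‖v (x - t)‖ ≤ B) :
    ‖iteratedFDeriv ℝ l (convolution v g L volume) x‖
      ≤ ‖L‖ * B * ∫ t, ‖iteratedFDeriv ℝ l g t‖ := by
  induction l generalizing G H with
  | zero => simpa using norm_convolution_le_of_bound hg.continuous hgc v L x hB
  | succ l ih =>
    have h1 : fderiv ℝ (convolution v g L volume)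
        = convolution v (fderiv ℝ g) (L.precompR E) volume :=
      funext fun y ↦ (hgc.hasFDerivAt_convolution_right L hv (hg.of_le (by simp)) y).fderiv
    rw [← norm_iteratedFDeriv_fderiv, h1]
    refine (ih (hg.fderiv_right (by simp)) (hgc.fderiv (𝕜 := ℝ)) (L.precompR E)
      fun t ht ↦ hB t (tsupport_fderiv_subset ℝ ht)).trans ?_
    simp only [norm_iteratedFDeriv_fderiv]
    gcongr
    exact ContinuousLinearMap.norm_precompR_le _ _

theorem mollify_one_eq_convolution (ζ : E → ℝ) (v : E → F) :
    mollify ζ 1 v = convolution v (fun t ↦ ζ (-t))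
      (ContinuousLinearMap.lsmul ℝ ℝ : ℝ →L[ℝ] F →L[ℝ] F).flip volume := by
  ext y
  rw [convolution_def, mollify,
    ← integral_add_left_eq_self (μ := volume) (fun t ↦ ((ContinuousLinearMap.lsmul ℝ ℝ :
      ℝ →L[ℝ] F →L[ℝ] F).flip (v t)) (ζ (-(y - t)))) y]
  simp

theorem mollify_eq_mollify_one (ζ : E → ℝ) {r : ℝ} (hr : r ≠ 0) (u : E → F) :
    mollify ζ r u = mollify ζ 1 (fun y ↦ u (r • y)) ∘ (r⁻¹ • ContinuousLinearMap.id ℝ E) := by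
  ext x
  simp [mollify, smul_add, smul_smul, hr]

theorem locallyIntegrable_comp_smul {u : E → F} (hu : LocallyIntegrable u) {r : ℝ} (hr : r ≠ 0) :
    LocallyIntegrable fun y ↦ u (r • y) := by
  rw [locallyIntegrable_iff] at hu ⊢
  intro K hK
  have h1 := hu _ (hK.image (continuous_const_smul r))
  rw [← integrable_indicator_iff (hK.image (continuous_const_smul r)).measurableSet] at h1
  rw [← integrable_indicator_iff hK.measurableSet]
  refine (h1.comp_smul hr).congr (Eventually.of_forall fun y ↦ ?_)
  have h2 : r • y ∈ (fun x ↦ r • x) '' K ↔ y ∈ K :=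
    ⟨fun ⟨z, hz, h⟩ ↦ (smul_right_injective E hr h) ▸ hz, fun h ↦ ⟨y, h, rfl⟩⟩
  change indicator _ u (r • y) = indicator K (fun y ↦ u (r • y)) y
  by_cases hy : y ∈ K
  · rw [indicator_of_mem (h2.2 hy), indicator_of_mem hy]
  · rw [indicator_of_notMem (mt h2.1 hy), indicator_of_notMem hy]

theorem contDiff_mollify {ζ : E → ℝ} (hζ : ContDiff ℝ ∞ ζ) (hζc : HasCompactSupport ζ) {r : ℝ}
    (hr : r ≠ 0) {u : E → F} (hu : LocallyIntegrable u) : ContDiff ℝ ∞ (mollify ζ r u) := by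
  rw [mollify_eq_mollify_one ζ hr, mollify_one_eq_convolution]
  exact (HasCompactSupport.contDiff_convolution_right (n := ⊤) _
    (hζc.comp_homeomorph (Homeomorph.neg E)) (locallyIntegrable_comp_smul hu hr)
    (hζ.comp contDiff_neg)).comp (ContinuousLinearMap.contDiff _)

theorem norm_iteratedFDeriv_mollify_le {ζ : E → ℝ} (hζ : ContDiff ℝ ∞ ζ)
    (hζc : HasCompactSupport ζ) (l : ℕ) {r : ℝ} (hr : 0 < r) {u : E → F}
    (hu : LocallyIntegrable u) (x : E) {B : ℝ} (hB0 : 0 ≤ B)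
    (hB : ∀ z ∈ tsupport ζ, ‖u (x + r • z)‖ ≤ B) :
    ‖iteratedFDeriv ℝ l (mollify ζ r u) x‖
      ≤ (∫ t, ‖iteratedFDeriv ℝ l (fun z ↦ ζ (-z)) t‖) * B * r⁻¹ ^ l := by
  have hζn : HasCompactSupport fun t ↦ ζ (-t) := hζc.comp_homeomorph (Homeomorph.neg E)
  have hv := locallyIntegrable_comp_smul hu hr.ne'
  have hcd : ContDiff ℝ ∞ (mollify ζ 1 (fun y ↦ u (r • y))) := by
    refine contDiff_mollify hζ hζc one_ne_zero hv
  rw [mollify_eq_mollify_one ζ hr.ne',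
    ContinuousLinearMap.iteratedFDeriv_comp_right _ hcd x (by exact_mod_cast le_top)]
  refine (ContinuousMultilinearMap.norm_compContinuousLinearMap_le _ _).trans ?_
  rw [Finset.prod_const, Finset.card_univ, Fintype.card_fin, mollify_one_eq_convolution]
  have h1 : ‖r⁻¹ • ContinuousLinearMap.id ℝ E‖ ≤ r⁻¹ := by
    rw [norm_smul, Real.norm_eq_abs, abs_of_pos (inv_pos.2 hr)]
    exact mul_le_of_le_one_right (by positivity) ContinuousLinearMap.norm_id_le
  have h2 : ‖(ContinuousLinearMap.lsmul ℝ ℝ : ℝ →L[ℝ] F →L[ℝ] F).flip‖ ≤ 1 := by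
    rw [ContinuousLinearMap.opNorm_flip]
    exact ContinuousLinearMap.opNorm_lsmul_le
  have hζs : ContDiff ℝ ∞ fun t ↦ ζ (-t) := hζ.comp contDiff_neg
  have h4 : ∀ t ∈ tsupport (fun t ↦ ζ (-t)),
      ‖(fun y ↦ u (r • y)) ((r⁻¹ • ContinuousLinearMap.id ℝ E) x - t)‖ ≤ B := by
    intro t ht
    have h5 : -t ∈ tsupport ζ := by
      have h6 : tsupport (fun t ↦ ζ (-t)) = (Homeomorph.neg E) ⁻¹' tsupport ζ :=
        tsupport_comp_eq_preimage ζ (Homeomorph.neg E)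
      rw [h6] at ht
      exact ht
    simpa [smul_sub, smul_smul, hr.ne', ← sub_eq_add_neg] using hB _ h5
  have h3 := norm_iteratedFDeriv_convolution_le l hζs hζn hv
    (ContinuousLinearMap.lsmul ℝ ℝ : ℝ →L[ℝ] F →L[ℝ] F).flip _ hB0 h4
  refine mul_le_mul (h3.trans ?_) (pow_le_pow_left₀ (norm_nonneg _) h1 l) (by positivity)
    (by positivity)
  rw [mul_comm]
  refine mul_le_mul_of_nonneg_left ?_ (by positivity)
  simpa using mul_le_mul_of_nonneg_right h2 hB0

end Mollifier

section MollifyDiff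

variable {E F : Type} [NormedAddCommGroup E] [NormedSpace ℝ E]
  [NormedAddCommGroup F] [NormedSpace ℝ F]
  [FiniteDimensional ℝ E] [MeasureSpace E] [BorelSpace E] [(volume : Measure E).IsAddHaarMeasure]

/-- A linear combination of mollifications at the scales `0, h, …, n * h`. -/
def mollifyDiff (c : ℕ → ℝ) (n : ℕ) (ζ : E → ℝ) (h : ℝ) (u : E → F) (x : E) : F :=
  ∑ i ∈ Finset.range (n + 1), c i • mollify ζ (i * h) u x

theorem fderiv_mollifyDiff (c : ℕ → ℝ) (n : ℕ) {ζ : E → ℝ} (hζ : Continuous ζ)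
    (hζc : HasCompactSupport ζ) (h : ℝ) {u : E → F} (hu : ContDiff ℝ 1 u)
    (huc : HasCompactSupport u) :
    fderiv ℝ (mollifyDiff c n ζ h u) = mollifyDiff c n ζ h (fderiv ℝ u) :=
  funext fun x ↦ (HasFDerivAt.fun_sum fun (i : ℕ) _ ↦
    (hasFDerivAt_mollify hζ hζc (i * h) hu huc x).const_smul (c i)).fderiv

theorem norm_iteratedFDeriv_mollifyDiff_le {c : ℕ → ℝ} {n : ℕ} {ζ : E → ℝ} (hζ : Continuous ζ)
    (hζc : HasCompactSupport ζ) {h θ A ρ : ℝ} (hh : 0 ≤ h) (hθ : 0 ≤ θ) (hA0 : 0 ≤ A)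
    (hρ : ∀ z ∈ tsupport ζ, ‖z‖ ≤ ρ) (l j k : ℕ) (hk : k = j + l)
    (hc : ∀ p ≤ l, ∑ i ∈ Finset.range (n + 1), c i * (i : ℝ) ^ p = 0)
    {u : E → F} (hu : ContDiff ℝ k u) (huc : HasCompactSupport u) (x : E)
    (hA : ∀ z ∈ tsupport ζ, ∀ s ∈ Icc (0 : ℝ) (n * h),
      ‖iteratedFDeriv ℝ k u (x + s • z) - iteratedFDeriv ℝ k u x‖ ≤ A * (s * ‖z‖) ^ θ) :
    ‖iteratedFDeriv ℝ j (mollifyDiff c n ζ h u) x‖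
      ≤ (∫ z, ‖ζ z‖) * ((∑ i ∈ Finset.range (n + 1), |c i| * (i : ℝ) ^ l * (i : ℝ) ^ θ)
        * A * (h * ρ) ^ l * (h * ρ) ^ θ) := by
  induction j generalizing F k with
  | zero =>
    obtain rfl : k = l := by omega
    rw [norm_iteratedFDeriv_zero]
    have h1 : mollifyDiff c n ζ h u x
        = ∫ z, ζ z • ∑ i ∈ Finset.range (n + 1), c i • u (x + (i : ℝ) • (h • z)) := by
      simp only [mollifyDiff, mollify, ← integral_smul]
      rw [← integral_finsetSum]
      · simp only [Finset.smul_sum, smul_smul, mul_comm (c _)]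
      · exact fun i _ ↦ (integrable_mollify hζ hζc _ hu.continuous x).smul (c i)
    rw [h1, ← integral_mul_const]
    refine norm_integral_le_of_norm_le
      ((hζ.integrable_of_hasCompactSupport hζc).norm.mul_const _)
      (Eventually.of_forall fun z ↦ ?_)
    by_cases hz : ζ z = 0
    · simp [hz]
    have hz' : z ∈ tsupport ζ := subset_tsupport _ hz
    have hn : ‖h • z‖ ≤ h * ρ := by
      rw [norm_smul, Real.norm_eq_abs, abs_of_nonneg hh]
      gcongr
      exact hρ z hz'
    have hn0 : 0 ≤ h * ρ := (norm_nonneg _).trans hn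
    rw [norm_smul]
    gcongr
    refine (norm_sum_smul_ray_le n hθ hA0 k u hu c hc x (h • z) fun s hs ↦ ?_).trans (by gcongr)
    rw [smul_smul, norm_smul, Real.norm_eq_abs, abs_of_nonneg hh, ← mul_assoc]
    exact hA z hz' (s * h) ⟨mul_nonneg hs.1 hh, by gcongr; exact hs.2⟩
  | succ j ih =>
    obtain ⟨k, rfl⟩ : ∃ k', k = k' + 1 := ⟨j + l, by omega⟩
    rw [← norm_iteratedFDeriv_fderiv,
      fderiv_mollifyDiff c n hζ hζc h (hu.of_le (by norm_cast; omega)) huc]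
    refine ih k (by omega) (hu.fderiv_right (by norm_cast)) (huc.fderiv (𝕜 := ℝ)) fun z hz s hs ↦ ?_
    rw [norm_iteratedFDeriv_fderiv_sub]
    exact hA z hz s hs

theorem norm_iteratedFDeriv_mollify_le_of_sub [CompleteSpace F] {ζ : E → ℝ} (hζ : ContDiff ℝ ∞ ζ)
    (hζc : HasCompactSupport ζ) {l : ℕ} (hl : l ≠ 0) {r : ℝ} (hr : 0 < r) (k : ℕ) {u : E → F}
    (hu : ContDiff ℝ k u) (huc : HasCompactSupport u) (x : E) {B : ℝ} (hB0 : 0 ≤ B)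
    (hB : ∀ z ∈ tsupport ζ,
      ‖iteratedFDeriv ℝ k u (x + r • z) - iteratedFDeriv ℝ k u x‖ ≤ B) :
    ‖iteratedFDeriv ℝ (k + l) (mollify ζ r u) x‖
      ≤ (∫ t, ‖iteratedFDeriv ℝ l (fun z ↦ ζ (-z)) t‖) * B * r⁻¹ ^ l := by
  induction k generalizing F with
  | zero =>
    have h1 : mollify ζ r u
        = fun y ↦ (∫ z, ζ z) • u x + mollify ζ r (fun y ↦ u y - u x) y := by
      ext y
      simp only [mollify, smul_sub]
      rw [integral_sub (integrable_mollify hζ.continuous hζc r hu.continuous y)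
        ((hζ.continuous.integrable_of_hasCompactSupport hζc).smul_const _), integral_smul_const]
      abel
    have hli : LocallyIntegrable fun y ↦ u y - u x :=
      (hu.continuous.sub continuous_const).locallyIntegrable
    have hcd := contDiff_mollify hζ hζc hr.ne' hli
    rw [zero_add, h1]
    change ‖iteratedFDeriv ℝ l ((fun _ ↦ (∫ z, ζ z) • u x) + mollify ζ r (fun y ↦ u y - u x)) x‖ ≤ _
    rw [iteratedFDeriv_add_apply contDiff_const.contDiffAt
      (hcd.of_le (by exact_mod_cast le_top)).contDiffAt, iteratedFDeriv_const_of_ne hl]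
    rw [Pi.zero_apply, zero_add]
    refine norm_iteratedFDeriv_mollify_le hζ hζc l hr hli x hB0 fun z hz ↦ ?_
    have := hB z hz
    rwa [norm_iteratedFDeriv_zero_sub] at this
  | succ k ih =>
    rw [show k + 1 + l = k + l + 1 by omega, ← norm_iteratedFDeriv_fderiv,
      fderiv_mollify hζ.continuous hζc r (hu.of_le (by norm_cast; omega)) huc]
    refine ih (hu.fderiv_right (by norm_cast)) (huc.fderiv (𝕜 := ℝ)) fun z hz ↦ ?_
    rw [norm_iteratedFDeriv_fderiv_sub]
    exact hB z hz

end MollifyDiff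

section Cone

variable {E : Type} [NormedAddCommGroup E] [NormedSpace ℝ E]

/-- Near `x₀`, the set `Ω` contains truncated open cones with axis `ν` and aperture `δ` whose
vertices are arbitrary points of the closure of `Ω`. -/
def HasConeAt (Ω : Set E) (x₀ ν : E) (δ r : ℝ) : Prop :=
  0 < δ ∧ 0 < r ∧ ∀ x ∈ closure Ω, dist x x₀ < r → ∀ s ∈ Ioo 0 r,
    ∀ z ∈ Metric.closedBall ν δ, x + s • z ∈ Ω

theorem exists_hasConeAt_of_mem {Ω : Set E} (hΩ : IsOpen Ω) {x₀ : E} (hx₀ : x₀ ∈ Ω) :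
    ∃ r, HasConeAt Ω x₀ 0 1 r := by
  obtain ⟨R, hR, hball⟩ := Metric.isOpen_iff.1 hΩ x₀ hx₀
  refine ⟨R / 2, one_pos, by positivity, fun x _ hx s hs z hz ↦ hball ?_⟩
  have h1 : ‖s • z‖ ≤ R / 2 := by
    rw [norm_smul, Real.norm_eq_abs, abs_of_pos hs.1]
    have : ‖z‖ ≤ 1 := by simpa using hz
    nlinarith [hs.1, hs.2, norm_nonneg z]
  rw [Metric.mem_ball]
  calc dist (x + s • z) x₀ ≤ dist (x + s • z) x + dist x x₀ := dist_triangle _ _ _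
    _ < R := by rw [dist_self_add_left]; linarith

theorem nonpos_of_mem_closure {Ω U : Set E} {φ : E → ℝ} (hU : IsOpen U) (hφ : Continuous φ)
    (h : Ω ∩ U = {y ∈ U | φ y < 0}) {x : E} (hx : x ∈ closure Ω) (hxU : x ∈ U) : φ x ≤ 0 := by
  have h1 : x ∈ closure (U ∩ Ω) := hU.inter_closure ⟨hxU, hx⟩
  have h2 : U ∩ Ω ⊆ {y | φ y ≤ 0} := fun y hy ↦ by
    have : y ∈ {y ∈ U | φ y < 0} := h ▸ ⟨hy.2, hy.1⟩
    exact this.2.le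
  exact closure_minimal h2 (isClosed_le hφ continuous_const) h1

theorem ContinuousLinearMap.exists_apply_neg {ℓ : E →L[ℝ] ℝ} (hℓ : ℓ ≠ 0) : ∃ v, ℓ v < 0 := by
  obtain ⟨v, hv⟩ : ∃ v, ℓ v ≠ 0 := by
    by_contra! h
    exact hℓ (ContinuousLinearMap.ext h)
  rcases hv.lt_or_gt with h | h
  · exact ⟨v, h⟩
  · exact ⟨-v, by simpa using h⟩

theorem lt_of_fderiv_neg_along_ray {φ : E → ℝ} (hφ : Differentiable ℝ φ) {x z : E} {s : ℝ}
    (hs : 0 < s) (h : ∀ τ ∈ Icc 0 s, fderiv ℝ φ (x + τ • z) z < 0) : φ (x + s • z) < φ x := by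
  have hd : ∀ τ : ℝ, HasDerivAt (fun τ ↦ φ (x + τ • z)) (fderiv ℝ φ (x + τ • z) z) τ := fun τ ↦ by
    have h1 : HasDerivAt (fun τ : ℝ ↦ x + τ • z) z τ := by
      simpa using ((hasDerivAt_id τ).smul_const z).const_add x
    exact (hφ _).hasFDerivAt.comp_hasDerivAt τ h1
  have h2 : StrictAntiOn (fun τ : ℝ ↦ φ (x + τ • z)) (Icc 0 s) :=
    strictAntiOn_of_deriv_neg (convex_Icc 0 s)
      (fun τ _ ↦ (hd τ).continuousAt.continuousWithinAt)
      fun τ hτ ↦ by rw [(hd τ).deriv]; exact h τ (interior_subset hτ)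
  simpa using h2 (left_mem_Icc.2 hs.le) (right_mem_Icc.2 hs.le) hs

theorem exists_hasConeAt_of_frontier {Ω U : Set E} {φ : E → ℝ} (hU : IsOpen U)
    (hφ : ContDiff ℝ ∞ φ) (h : Ω ∩ U = {y ∈ U | φ y < 0}) {x₀ : E} (hx₀ : x₀ ∈ U)
    (hd : fderiv ℝ φ x₀ ≠ 0) : ∃ ν δ r, HasConeAt Ω x₀ ν δ r := by
  obtain ⟨ν, hν⟩ := ContinuousLinearMap.exists_apply_neg hd
  have hcont : Continuous fun p : E × E ↦ fderiv ℝ φ p.1 p.2 :=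
    ((hφ.continuous_fderiv (by simp)).comp continuous_fst).clm_apply continuous_snd
  have hnhds : {p : E × E | fderiv ℝ φ p.1 p.2 < 0 ∧ p.1 ∈ U} ∈ 𝓝 (x₀, ν) :=
    ((isOpen_lt hcont continuous_const).inter (hU.preimage continuous_fst)).mem_nhds ⟨hν, hx₀⟩
  obtain ⟨R, hR, hball⟩ := Metric.mem_nhds_iff.1 hnhds
  have hpos : 0 < 1 + ‖ν‖ + R := by positivity
  have hr : 0 < R / (2 * (1 + ‖ν‖ + R)) := by positivity
  have key : ∀ x : E, dist x x₀ < R / (2 * (1 + ‖ν‖ + R)) →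
      ∀ τ ∈ Ico 0 (R / (2 * (1 + ‖ν‖ + R))), ∀ z ∈ Metric.closedBall ν (R / 2),
      fderiv ℝ φ (x + τ • z) z < 0 ∧ x + τ • z ∈ U := by
    intro x hx τ hτ z hz
    have hz' : dist z ν < R := (Metric.mem_closedBall.1 hz).trans_lt (by linarith)
    have hzn : ‖z‖ ≤ ‖ν‖ + R := by
      have := norm_le_norm_add_norm_sub' z ν
      rw [← dist_eq_norm] at this
      linarith
    have h1 : dist (x + τ • z) x₀ < R := by
      calc dist (x + τ • z) x₀ ≤ dist (x + τ • z) x + dist x x₀ := dist_triangle _ _ _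
        _ = τ * ‖z‖ + dist x x₀ := by
          rw [dist_self_add_left, norm_smul, Real.norm_eq_abs, abs_of_nonneg hτ.1]
        _ < R / (2 * (1 + ‖ν‖ + R)) * (‖ν‖ + R) + R / (2 * (1 + ‖ν‖ + R)) := by
          refine add_lt_add_of_le_of_lt ?_ hx
          exact mul_le_mul hτ.2.le hzn (norm_nonneg _) hr.le
        _ = R / 2 := by field_simp; ring
        _ < R := by linarith
    exact hball (show (x + τ • z, z) ∈ Metric.ball (x₀, ν) R from by
      rw [Metric.mem_ball, Prod.dist_eq]; exact max_lt h1 hz')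
  refine ⟨ν, R / 2, R / (2 * (1 + ‖ν‖ + R)), by positivity, hr, fun x hx hxd s hs z hz ↦ ?_⟩
  have hxU : x ∈ U := by simpa using (key x hxd 0 ⟨le_rfl, hr⟩ z hz).2
  have h1 := nonpos_of_mem_closure hU hφ.continuous h hx hxU
  have h2 := lt_of_fderiv_neg_along_ray (hφ.differentiable (by simp)) (x := x) (z := z) hs.1
    fun τ hτ ↦ (key x hxd τ ⟨hτ.1, hτ.2.trans_lt hs.2⟩ z hz).1
  have h3 : x + s • z ∈ {y ∈ U | φ y < 0} :=
    ⟨(key x hxd s ⟨hs.1.le, hs.2⟩ z hz).2, h2.trans_le h1⟩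
  rw [← h] at h3
  exact h3.1

theorem HasConeAt.uniqueDiffWithinAt {Ω : Set E} {x₀ ν : E} {δ r : ℝ}
    (h : HasConeAt Ω x₀ ν δ r) (hx₀ : x₀ ∈ closure Ω) :
    UniqueDiffWithinAt ℝ (closure Ω) x₀ := by
  obtain ⟨hδ, hr, h⟩ := h
  have hs : (convexHull ℝ ((fun z ↦ x₀ + (r / 2) • z) '' Metric.ball ν δ ∪ {x₀})).Nonempty :=
    ⟨x₀, subset_convexHull _ _ (by simp)⟩
  have himg : IsOpen ((fun z ↦ x₀ + (r / 2) • z) '' Metric.ball ν δ) := by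
    have := (Homeomorph.smulOfNeZero (r / 2) (by positivity : r / 2 ≠ 0)).trans
      (Homeomorph.addLeft x₀) |>.isOpenMap (Metric.ball ν δ) Metric.isOpen_ball
    exact this
  have hne : ((fun z ↦ x₀ + (r / 2) • z) '' Metric.ball ν δ).Nonempty :=
    (Metric.nonempty_ball.2 hδ).image _
  have hconv : Convex ℝ ((fun z ↦ x₀ + (r / 2) • z) '' Metric.ball ν δ) := by
    have := ((convex_ball ν δ).smul (r / 2)).vadd x₀
    simpa [← image_smul, ← image_vadd, image_image] using this
  have hsub : convexHull ℝ ((fun z ↦ x₀ + (r / 2) • z) '' Metric.ball ν δ ∪ {x₀})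
      ⊆ closure Ω := by
    rw [union_comm, singleton_union, convexHull_insert hne, hconv.convexHull_eq]
    rintro y hy
    simp only [convexJoin_singleton_left, mem_iUnion, mem_image] at hy
    obtain ⟨_, ⟨z, hz, rfl⟩, hy⟩ := hy
    rw [segment_eq_image'] at hy
    obtain ⟨τ, hτ, rfl⟩ := hy
    rcases hτ.1.eq_or_lt with rfl | hτ0
    · simpa using hx₀
    · refine subset_closure ?_
      have := h x₀ hx₀ (by simpa using hr) (τ * (r / 2)) ⟨by positivity, by nlinarith [hτ.2]⟩ z
        (Metric.ball_subset_closedBall hz)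
      simpa [smul_smul] using this
  refine (uniqueDiffWithinAt_convex (convex_convexHull ℝ _) ?_
    (subset_closure (subset_convexHull _ _ (by simp)))).mono hsub
  exact hne.mono (interior_maximal (subset_union_left.trans (subset_convexHull _ _)) himg)

theorem HasConeAt.norm_sub_le {Ω : Set E} {x₀ ν : E} {δ r : ℝ} (h : HasConeAt Ω x₀ ν δ r)
    {F : Type} [NormedAddCommGroup F] [NormedSpace ℝ F] {G : E → F} {B : ℝ}
    (hG : DifferentiableOn ℝ G (closure Ω)) (hB : ∀ x ∈ closure Ω, ‖fderivWithin ℝ G (closure Ω) x‖ ≤ B)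
    {x y : E} (hx : x ∈ closure Ω) (hy : y ∈ closure Ω) (hxd : dist x x₀ < r) (hyd : dist y x₀ < r)
    (hxy : ‖x - y‖ < r * δ) : ‖G x - G y‖ ≤ (1 + 2 * ‖ν‖ / δ) * B * ‖x - y‖ := by
  obtain ⟨hδ, hr, h⟩ := h
  rcases eq_or_ne x y with rfl | hne
  · simp
  have hpos : 0 < ‖x - y‖ := norm_pos_iff.2 (sub_ne_zero.2 hne)
  set s := ‖x - y‖ / δ with hs
  have hs0 : 0 < s := by positivity
  have hsr : s < r := by rw [hs, div_lt_iff₀ hδ]; exact hxy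
  have mvt : ∀ a b : E, segment ℝ a b ⊆ closure Ω → ‖G b - G a‖ ≤ B * ‖b - a‖ := fun a b hab ↦
    (convex_segment a b).norm_image_sub_le_of_norm_hasFDerivWithin_le
      (fun z hz ↦ (hG z (hab hz)).hasFDerivWithinAt.mono hab) (fun z hz ↦ hB z (hab hz))
      (left_mem_segment ℝ a b) (right_mem_segment ℝ a b)
  have ray : ∀ a ∈ closure Ω, dist a x₀ < r → segment ℝ a (a + s • ν) ⊆ closure Ω := by
    intro a ha had z hz
    rw [segment_eq_image'] at hz
    obtain ⟨τ, hτ, rfl⟩ := hz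
    rcases hτ.1.eq_or_lt with rfl | hτ0
    · simpa using ha
    · have := h a ha had (τ * s) ⟨by positivity, by nlinarith [hτ.2]⟩ ν
        (Metric.mem_closedBall_self hδ.le)
      exact subset_closure (by simpa [smul_smul] using this)
  have mid : segment ℝ (x + s • ν) (y + s • ν) ⊆ closure Ω := by
    intro z hz
    rw [segment_eq_image'] at hz
    obtain ⟨τ, hτ, rfl⟩ := hz
    have h1 : ν + (τ / s) • (y - x) ∈ Metric.closedBall ν δ := by
      rw [Metric.mem_closedBall, dist_self_add_left, norm_smul, Real.norm_eq_abs,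
        abs_of_nonneg (div_nonneg hτ.1 hs0.le), norm_sub_rev, hs]
      have : τ / (‖x - y‖ / δ) * ‖x - y‖ = τ * δ := by field_simp
      rw [this]
      nlinarith [hτ.2]
    have h2 := h x hx hxd s ⟨hs0, hsr⟩ _ h1
    refine subset_closure ?_
    convert h2 using 1
    rw [smul_add, smul_smul, mul_div_cancel₀ _ hs0.ne']
    simp only [add_sub_add_right_eq_sub]
    abel
  have e1 := mvt _ _ (ray x hx hxd)
  have e2 := mvt _ _ mid
  have e3 := mvt _ _ (ray y hy hyd)
  simp only [add_sub_cancel_left, add_sub_add_right_eq_sub, norm_smul, Real.norm_eq_abs,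
    abs_of_pos hs0] at e1 e2 e3
  rw [norm_sub_rev y x] at e2
  have e4 : G x - G y = -(G (x + s • ν) - G x) + -(G (y + s • ν) - G (x + s • ν))
      + (G (y + s • ν) - G y) := by abel
  calc ‖G x - G y‖ ≤ B * (s * ‖ν‖) + B * ‖x - y‖ + B * (s * ‖ν‖) := by
        rw [e4]
        refine norm_add₃_le.trans ?_
        rw [norm_neg, norm_neg]
        gcongr
    _ = (1 + 2 * ‖ν‖ / δ) * B * ‖x - y‖ := by rw [hs]; field_simp; ring

theorem exists_norm_sub_le_of_cone {Ω : Set E} (hK : IsCompact (closure Ω))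
    (hcone : ∀ x₀ ∈ closure Ω, ∃ ν δ r, HasConeAt Ω x₀ ν δ r) :
    ∃ r₀ > 0, ∃ M > 0, ∀ (F : Type) [NormedAddCommGroup F] [NormedSpace ℝ F] (G : E → F) (B : ℝ),
      0 ≤ B → DifferentiableOn ℝ G (closure Ω) →
      (∀ x ∈ closure Ω, ‖fderivWithin ℝ G (closure Ω) x‖ ≤ B) →
      ∀ x ∈ closure Ω, ∀ y ∈ closure Ω, ‖x - y‖ < r₀ → ‖G x - G y‖ ≤ M * B * ‖x - y‖ := by
  suffices H : ∃ r₀ > 0, ∃ M > 0, ∀ (F : Type) [NormedAddCommGroup F] [NormedSpace ℝ F]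
      (G : E → F) (B : ℝ), 0 ≤ B → DifferentiableOn ℝ G (closure Ω) →
      (∀ x ∈ closure Ω, ‖fderivWithin ℝ G (closure Ω) x‖ ≤ B) →
      ∀ x ∈ closure Ω, x ∈ closure Ω → ∀ y ∈ closure Ω, ‖x - y‖ < r₀ →
        ‖G x - G y‖ ≤ M * B * ‖x - y‖ by
    obtain ⟨r₀, hr₀, M, hM, H⟩ := H
    exact ⟨r₀, hr₀, M, hM, fun F _ _ G B h0 h1 h2 x hx ↦ H F G B h0 h1 h2 x hx hx⟩
  refine hK.induction_on (p := fun S ↦ ∃ r₀ > 0, ∃ M > 0, ∀ (F : Type) [NormedAddCommGroup F]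
      [NormedSpace ℝ F] (G : E → F) (B : ℝ), 0 ≤ B → DifferentiableOn ℝ G (closure Ω) →
      (∀ x ∈ closure Ω, ‖fderivWithin ℝ G (closure Ω) x‖ ≤ B) →
      ∀ x ∈ S, x ∈ closure Ω → ∀ y ∈ closure Ω, ‖x - y‖ < r₀ →
        ‖G x - G y‖ ≤ M * B * ‖x - y‖) ?_ ?_ ?_ ?_
  · exact ⟨1, one_pos, 1, one_pos, fun F _ _ G B _ _ _ x hx ↦ hx.elim⟩
  · rintro S T hST ⟨r₀, hr₀, M, hM, H⟩
    exact ⟨r₀, hr₀, M, hM, fun F _ _ G B h0 h1 h2 x hx ↦ H F G B h0 h1 h2 x (hST hx)⟩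
  · rintro S T ⟨r₁, hr₁, M₁, hM₁, H₁⟩ ⟨r₂, hr₂, M₂, hM₂, H₂⟩
    refine ⟨min r₁ r₂, lt_min hr₁ hr₂, max M₁ M₂, lt_max_of_lt_left hM₁,
      fun F _ _ G B h0 h1 h2 x hx hxK y hy hxy ↦ ?_⟩
    rcases hx with hx | hx
    · refine (H₁ F G B h0 h1 h2 x hx hxK y hy (hxy.trans_le (min_le_left _ _))).trans ?_
      gcongr
      exact le_max_left _ _
    · refine (H₂ F G B h0 h1 h2 x hx hxK y hy (hxy.trans_le (min_le_right _ _))).trans ?_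
      gcongr
      exact le_max_right _ _
  · intro x₀ hx₀
    obtain ⟨ν, δ, r, h⟩ := hcone x₀ hx₀
    have hδ := h.1
    have hr := h.2.1
    refine ⟨Metric.ball x₀ (r / 2), mem_nhdsWithin_of_mem_nhds (Metric.ball_mem_nhds _ (by positivity)),
      min (r / 2) (r * δ), lt_min (by positivity) (by positivity), 1 + 2 * ‖ν‖ / δ, by positivity,
      fun F _ _ G B h0 h1 h2 x hx hxK y hy hxy ↦ ?_⟩
    rw [Metric.mem_ball] at hx
    refine h.norm_sub_le h1 h2 hxK hy (by linarith) ?_ (hxy.trans_le (min_le_right _ _))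
    have h3 : dist y x < r / 2 := by
      rw [dist_comm, dist_eq_norm]; exact hxy.trans_le (min_le_left _ _)
    linarith [dist_triangle y x x₀]

end Cone

section LocalSmoothing

variable {E : Type} [NormedAddCommGroup E] [NormedSpace ℝ E] [FiniteDimensional ℝ E]

open scoped Manifold in
theorem exists_contDiff_eqOn_of_isCompact {Ω Q : Set E} (hΩ : IsOpen Ω) (hQ : IsCompact Q)
    (hQΩ : Q ⊆ Ω) {f : E → ℝ} {k : ℕ} (hf : ContDiffOn ℝ k f Ω) :
    ∃ g : E → ℝ, ContDiff ℝ k g ∧ HasCompactSupport g ∧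
      ∃ W, IsOpen W ∧ Q ⊆ W ∧ W ⊆ Ω ∧ EqOn g f W := by
  obtain ⟨η, hη, hηΩ⟩ := hQ.exists_cthickening_subset_open hΩ hQΩ
  have hQi : Q ⊆ interior (Metric.cthickening η Q) :=
    (Metric.self_subset_thickening hη Q).trans
      (interior_maximal (Metric.thickening_subset_cthickening _ _) Metric.isOpen_thickening)
  obtain ⟨χ, hχ1, hχ0, -⟩ := exists_contMDiffMap_one_nhds_of_subset_interior (n := ⊤) 𝓘(ℝ, E)
    hQ.isClosed hQi
  have hχ : ContDiff ℝ ∞ χ := χ.contMDiff.contDiff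
  obtain ⟨W, hW, hQW, hWχ⟩ := eventually_nhdsSet_iff_exists.1 hχ1
  have h0 : ∀ y ∉ Metric.cthickening η Q, χ y * f y = 0 := fun y hy ↦ by rw [hχ0 y hy, zero_mul]
  refine ⟨fun y ↦ χ y * f y, ?_, HasCompactSupport.intro hQ.cthickening h0, W ∩ Ω, hW.inter hΩ,
    subset_inter hQW hQΩ, inter_subset_right, fun y hy ↦ by simp [hWχ y hy.1]⟩
  refine contDiff_iff_contDiffAt.2 fun y ↦ ?_
  by_cases hy : y ∈ Ω
  · exact (hχ.of_le (by exact_mod_cast le_top)).contDiffAt.mul (hf.contDiffAt (hΩ.mem_nhds hy))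
  · have : (fun y ↦ χ y * f y) =ᶠ[𝓝 y] fun _ ↦ 0 := by
      filter_upwards [Metric.isClosed_cthickening.isOpen_compl.mem_nhds fun h ↦ hy (hηΩ h)]
        with z hz using h0 z hz
    exact contDiffAt_const.congr_of_eventuallyEq this

theorem iteratedFDerivWithin_eq_of_eventuallyEq {F : Type} [NormedAddCommGroup F]
    [NormedSpace ℝ F] {f g : E → F} {s : Set E} {x : E} (hs : s ∈ 𝓝 x) (h : f =ᶠ[𝓝 x] g) (j : ℕ) :
    iteratedFDerivWithin ℝ j f s x = iteratedFDeriv ℝ j g x := by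
  rw [iteratedFDerivWithin_congr_set (t := univ) (eventuallyEq_univ.2 hs), iteratedFDerivWithin_univ]
  exact (h.iteratedFDeriv ℝ j).eq_of_nhds

theorem norm_le_of_forall_mem_open {F : Type} [NormedAddCommGroup F] {Ω V : Set E} {G : E → F}
    (hV : IsOpen V) (hG : ContinuousOn G (closure Ω)) {B : ℝ} (h : ∀ x ∈ Ω ∩ V, ‖G x‖ ≤ B) :
    ∀ x ∈ closure Ω ∩ V, ‖G x‖ ≤ B := by
  rintro x ⟨hx, hxV⟩
  have h1 : x ∈ closure (Ω ∩ V) := by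
    rw [inter_comm]; exact hV.inter_closure ⟨hxV, hx⟩
  exact ContinuousWithinAt.closure_le h1
    ((hG x hx).norm.mono (inter_subset_left.trans subset_closure))
    continuousWithinAt_const h

variable [MeasureSpace E] [BorelSpace E] [(volume : Measure E).IsAddHaarMeasure]

theorem mollify_congr {F : Type} [NormedAddCommGroup F] [NormedSpace ℝ F] {ζ : E → ℝ} {r : ℝ}
    {u v : E → F} {x : E} (h : ∀ z ∈ tsupport ζ, u (x + r • z) = v (x + r • z)) :
    mollify ζ r u x = mollify ζ r v x := by
  refine integral_congr_ae (Eventually.of_forall fun z ↦ ?_)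
  by_cases hz : ζ z = 0
  · simp [hz]
  · simp only
    rw [h z (subset_tsupport _ hz)]

theorem mollify_zero {F : Type} [NormedAddCommGroup F] [NormedSpace ℝ F] [CompleteSpace F]
    {ζ : E → ℝ} (hζ : ∫ z, ζ z = 1) (u : E → F) (x : E) : mollify ζ 0 u x = u x := by
  simp [mollify, integral_smul_const, hζ]

/-- The smooth approximation obtained by dropping the unmollified term of `mollifyDiff`. -/
def mollifyTail (c : ℕ → ℝ) (n : ℕ) (ζ : E → ℝ) (h : ℝ) (u : E → ℝ) (x : E) : ℝ :=
  ∑ i ∈ Finset.range n, -(c (i + 1)) • mollify ζ ((i + 1 : ℕ) * h) u x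

theorem mollifyDiff_eq_sub_mollifyTail {c : ℕ → ℝ} (hc : c 0 = 1) (n : ℕ) {ζ : E → ℝ}
    (hζ : ∫ z, ζ z = 1) (h : ℝ) (u : E → ℝ) (x : E) :
    mollifyDiff c n ζ h u x = u x - mollifyTail c n ζ h u x := by
  rw [mollifyDiff, Finset.sum_range_succ', mollifyTail]
  simp only [Nat.cast_zero, zero_mul, mollify_zero hζ, hc, one_smul, neg_smul,
    Finset.sum_neg_distrib]
  ring

theorem contDiff_mollifyTail (c : ℕ → ℝ) (n : ℕ) {ζ : E → ℝ} (hζ : ContDiff ℝ ∞ ζ)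
    (hζc : HasCompactSupport ζ) {h : ℝ} (hh : 0 < h) {u : E → ℝ} (hu : LocallyIntegrable u) :
    ContDiff ℝ ∞ (mollifyTail c n ζ h u) :=
  ContDiff.sum fun _ _ ↦ (contDiff_mollify hζ hζc (by positivity) hu).const_smul _

theorem norm_iteratedFDeriv_mollifyTail_le (c : ℕ → ℝ) (n : ℕ) {ζ : E → ℝ} (hζ : ContDiff ℝ ∞ ζ)
    (hζc : HasCompactSupport ζ) {h θ A ρ : ℝ} (hh : 0 < h) (hθ : 0 ≤ θ) (hA0 : 0 ≤ A)
    (hρ0 : 0 ≤ ρ) (hρ : ∀ z ∈ tsupport ζ, ‖z‖ ≤ ρ) (l k : ℕ) (hl : l ≠ 0)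
    {u : E → ℝ} (hu : ContDiff ℝ k u) (huc : HasCompactSupport u) (x : E)
    (hA : ∀ z ∈ tsupport ζ, ∀ s ∈ Icc (0 : ℝ) (n * h),
      ‖iteratedFDeriv ℝ k u (x + s • z) - iteratedFDeriv ℝ k u x‖ ≤ A * (s * ‖z‖) ^ θ) :
    ‖iteratedFDeriv ℝ (k + l) (mollifyTail c n ζ h u) x‖
      ≤ (∑ i ∈ Finset.range n, |c (i + 1)| * ((∫ t, ‖iteratedFDeriv ℝ l (fun z ↦ ζ (-z)) t‖)
          * (n * ρ) ^ θ)) * A * h ^ θ * h⁻¹ ^ l := by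
  have hcd : ∀ i : ℕ, ContDiff ℝ ((k + l : ℕ) : WithTop ℕ∞) (mollify ζ ((i + 1 : ℕ) * h) u) :=
    fun i ↦ (contDiff_mollify hζ hζc (by positivity) hu.continuous.locallyIntegrable).of_le
      (by exact_mod_cast le_top)
  change ‖iteratedFDeriv ℝ (k + l) (fun x ↦ ∑ i ∈ Finset.range n,
    (-(c (i + 1)) • mollify ζ ((i + 1 : ℕ) * h) u) x) x‖ ≤ _
  rw [iteratedFDeriv_sum (f := fun i ↦ -c (i + 1) • mollify ζ ((i + 1 : ℕ) * h) u)
    fun i _ ↦ (hcd i).const_smul (-c (i + 1)), Finset.sum_apply, Finset.sum_mul,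
    Finset.sum_mul, Finset.sum_mul]
  refine norm_sum_le_of_le _ fun i hi ↦ ?_
  have hin : ((i + 1 : ℕ) : ℝ) ≤ n := by exact_mod_cast Finset.mem_range.1 hi
  rw [iteratedFDeriv_const_smul_apply (hcd i).contDiffAt, norm_smul, norm_neg, Real.norm_eq_abs]
  have h1 := norm_iteratedFDeriv_mollify_le_of_sub hζ hζc hl
    (r := (i + 1 : ℕ) * h) (by positivity) k hu huc x (B := A * (n * h * ρ) ^ θ) (by positivity)
    fun z hz ↦ (hA z hz _ ⟨by positivity, by gcongr⟩).trans (by gcongr; exact hρ z hz)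
  have h2 : ((i + 1 : ℕ) * h)⁻¹ ≤ h⁻¹ := by
    refine inv_anti₀ hh ?_
    have : (1 : ℝ) ≤ (i + 1 : ℕ) := by exact_mod_cast Nat.le_add_left 1 i
    nlinarith
  have h3 : (n * h * ρ : ℝ) ^ θ = (n * ρ) ^ θ * h ^ θ := by
    rw [← Real.mul_rpow (by positivity) hh.le]; ring_nf
  have hI : 0 ≤ ∫ t, ‖iteratedFDeriv ℝ l (fun z ↦ ζ (-z)) t‖ :=
    integral_nonneg fun _ ↦ norm_nonneg _
  calc |c (i + 1)| * ‖iteratedFDeriv ℝ (k + l) (mollify ζ ((i + 1 : ℕ) * h) u) x‖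
      ≤ |c (i + 1)| * ((∫ t, ‖iteratedFDeriv ℝ l (fun z ↦ ζ (-z)) t‖) * (A * (n * h * ρ) ^ θ)
        * h⁻¹ ^ l) := by
        gcongr
        refine h1.trans ?_
        gcongr
    _ = _ := by rw [h3]; ring

theorem exists_smooth_approx_of_cone {Ω : Set E} (hΩ : IsOpen Ω) (hK : IsCompact (closure Ω))
    (hud : UniqueDiffOn ℝ (closure Ω)) {x₀ ν : E} {δ r : ℝ} (hcone : HasConeAt Ω x₀ ν δ r)
    (k : ℕ) {θ : ℝ} (hθ : 0 ≤ θ) :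
    ∃ C : ℕ → ℝ, (∀ j, 0 ≤ C j) ∧ ∃ ε₀ > 0, ∀ (f : E → ℝ) (A ε : ℝ), 0 ≤ A → 0 < ε → ε ≤ ε₀ →
      ContDiffOn ℝ k f (closure Ω) →
      (∀ x ∈ closure Ω, ∀ y ∈ closure Ω,
        ‖iteratedFDerivWithin ℝ k f (closure Ω) x - iteratedFDerivWithin ℝ k f (closure Ω) y‖
          ≤ A * ‖x - y‖ ^ θ) →
      ∃ F : E → ℝ, ContDiff ℝ ∞ F ∧ ∀ x ∈ closure Ω ∩ Metric.ball x₀ r,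
        (∀ j ≤ k, ‖iteratedFDerivWithin ℝ j (f - F) (closure Ω) x‖
          ≤ C j * A * ε ^ (k + θ - j : ℝ)) ∧
        (∀ j > k, ‖iteratedFDeriv ℝ j F x‖ ≤ C j * A * ε ^ (k + θ - j : ℝ)) := by
  obtain ⟨hδ, hr, hcone⟩ := hcone
  obtain ⟨c, hc0, hc⟩ := exists_moment_coefficients k
  let b : ContDiffBump ν := ⟨δ / 2, δ, by positivity, by linarith⟩
  set ζ : E → ℝ := b.normed volume with hζdef
  have hζ : ContDiff ℝ ∞ ζ := b.contDiff_normed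
  have hζc : HasCompactSupport ζ := b.hasCompactSupport_normed
  have hζ1 : ∫ z, ζ z = 1 := b.integral_normed
  have hζs : tsupport ζ = Metric.closedBall ν δ := b.tsupport_normed_eq
  set ρ := ‖ν‖ + δ with hρdef
  have hρ0 : 0 ≤ ρ := by positivity
  have hρ : ∀ z ∈ tsupport ζ, ‖z‖ ≤ ρ := fun z hz ↦ by
    rw [hζs, Metric.mem_closedBall, dist_eq_norm] at hz
    linarith [norm_le_norm_add_norm_sub' z ν]
  have hI : 0 ≤ ∫ z, ‖ζ z‖ := integral_nonneg fun _ ↦ norm_nonneg _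
  have hI' : ∀ l, 0 ≤ ∫ t, ‖iteratedFDeriv ℝ l (fun z ↦ ζ (-z)) t‖ :=
    fun l ↦ integral_nonneg fun _ ↦ norm_nonneg _
  refine ⟨fun j ↦ if j ≤ k then (∫ z, ‖ζ z‖) * ((∑ i ∈ Finset.range (k + 1 + 1),
      |c i| * (i : ℝ) ^ (k - j) * (i : ℝ) ^ θ) * ρ ^ (k - j) * ρ ^ θ)
    else ∑ i ∈ Finset.range (k + 1), |c (i + 1)| *
      ((∫ t, ‖iteratedFDeriv ℝ (j - k) (fun z ↦ ζ (-z)) t‖) * ((k + 1 : ℕ) * ρ) ^ θ),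
    fun j ↦ ?_, r / (k + 2), by positivity, fun f A ε hA0 hε hε₀ hf hA ↦ ?_⟩
  · beta_reduce
    split_ifs
    · positivity
    · exact Finset.sum_nonneg fun i _ ↦ mul_nonneg (abs_nonneg _) (mul_nonneg (hI' _) (by positivity))
  have hnε : ((k + 1 : ℕ) : ℝ) * ε < r := by
    rw [le_div_iff₀ (by positivity)] at hε₀
    push_cast
    nlinarith
  set u : E → ℝ := indicator (closure Ω) f with hu
  have hui : LocallyIntegrable u :=
    ((integrable_indicator_iff hK.measurableSet).2
      (hf.continuousOn.integrableOn_compact hK)).locallyIntegrable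
  set F := mollifyTail c (k + 1) ζ ε u with hF
  have hFs : ContDiff ℝ ∞ F := contDiff_mollifyTail c _ hζ hζc hε hui
  have main : ∀ x ∈ Ω ∩ Metric.ball x₀ r, ∃ g : E → ℝ, ContDiff ℝ k g ∧ HasCompactSupport g ∧
      f =ᶠ[𝓝 x] g ∧ F =ᶠ[𝓝 x] mollifyTail c (k + 1) ζ ε g ∧
      ∀ z ∈ tsupport ζ, ∀ s ∈ Icc (0 : ℝ) ((k + 1 : ℕ) * ε),
        ‖iteratedFDeriv ℝ k g (x + s • z) - iteratedFDeriv ℝ k g x‖ ≤ A * (s * ‖z‖) ^ θ := by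
    rintro x ⟨hx, hxr⟩
    set Q : Set E := (fun p : ℝ × E ↦ x + p.1 • p.2) ''
      (Icc (0 : ℝ) ((k + 1 : ℕ) * ε) ×ˢ Metric.closedBall ν δ) with hQdef
    have hQ : IsCompact Q := (isCompact_Icc.prod (isCompact_closedBall ν δ)).image (by fun_prop)
    have hmem : ∀ z ∈ tsupport ζ, ∀ s ∈ Icc (0 : ℝ) ((k + 1 : ℕ) * ε), x + s • z ∈ Q :=
      fun z hz s hs ↦ ⟨(s, z), ⟨hs, hζs ▸ hz⟩, rfl⟩
    have hxQ : x ∈ Q := ⟨(0, ν), ⟨⟨le_rfl, by positivity⟩, Metric.mem_closedBall_self hδ.le⟩, by simp⟩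
    have hQΩ : Q ⊆ Ω := by
      rintro _ ⟨⟨s, z⟩, ⟨hs, hz⟩, rfl⟩
      rcases hs.1.eq_or_lt with h0 | h0
      · simp only at h0
        simpa [← h0] using hx
      · exact hcone x (subset_closure hx) hxr s ⟨h0, hs.2.trans_lt hnε⟩ z hz
    obtain ⟨g, hg, hgc, W, hW, hQW, hWΩ, hgf⟩ := exists_contDiff_eqOn_of_isCompact hΩ hQ hQΩ
      (hf.mono subset_closure)
    have hD : ∀ y ∈ Q, iteratedFDerivWithin ℝ k f (closure Ω) y = iteratedFDeriv ℝ k g y :=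
      fun y hy ↦ iteratedFDerivWithin_eq_of_eventuallyEq
        (mem_of_superset (hΩ.mem_nhds (hQΩ hy)) subset_closure)
        (hgf.symm.eventuallyEq_of_mem (hW.mem_nhds (hQW hy))) k
    refine ⟨g, hg, hgc, hgf.symm.eventuallyEq_of_mem (hW.mem_nhds (hQW hxQ)), ?_, ?_⟩
    · obtain ⟨η, hη, hηW⟩ := hQ.exists_thickening_subset_open hW hQW
      filter_upwards [Metric.ball_mem_nhds x hη] with y hy
      refine Finset.sum_congr rfl fun i hi ↦ ?_
      congr 1
      refine mollify_congr fun z hz ↦ ?_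
      have hin : ((i + 1 : ℕ) : ℝ) ≤ (k + 1 : ℕ) := by exact_mod_cast Finset.mem_range.1 hi
      have h1 : y + (((i + 1 : ℕ) : ℝ) * ε) • z ∈ W := hηW <| Metric.mem_thickening_iff.2
        ⟨_, hmem z hz ((i + 1 : ℕ) * ε) ⟨by positivity, by gcongr⟩, by
          rw [dist_add_right]; exact hy⟩
      rw [hgf h1, hu, indicator_of_mem (subset_closure (hWΩ h1))]
    · intro z hz s hs
      rw [← hD _ (hmem z hz s hs), ← hD _ hxQ]
      refine (hA _ (subset_closure (hQΩ (hmem z hz s hs))) _ (subset_closure hx)).trans_eq ?_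
      rw [add_sub_cancel_left, norm_smul, Real.norm_eq_abs, abs_of_nonneg hs.1]
  refine ⟨F, hFs, fun x hx ↦ ⟨fun j hj ↦ ?_, fun j hj ↦ ?_⟩⟩
  · beta_reduce
    rw [if_pos hj]
    have hcd : ContDiffOn ℝ k (f - F) (closure Ω) :=
      hf.sub (hFs.of_le (by exact_mod_cast le_top)).contDiffOn
    refine norm_le_of_forall_mem_open Metric.isOpen_ball
      (hcd.continuousOn_iteratedFDerivWithin (by exact_mod_cast hj) hud) (fun y hy ↦ ?_) x hx
    obtain ⟨g, hg, hgc, hfg, hFg, hAg⟩ := main y hy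
    have h1 : f - F =ᶠ[𝓝 y] mollifyDiff c (k + 1) ζ ε g := by
      filter_upwards [hfg, hFg] with w h1 h2
      rw [Pi.sub_apply, h1, h2, mollifyDiff_eq_sub_mollifyTail hc0 _ hζ1]
    rw [iteratedFDerivWithin_eq_of_eventuallyEq
      (mem_of_superset (hΩ.mem_nhds hy.1) subset_closure) h1]
    refine (norm_iteratedFDeriv_mollifyDiff_le hζ.continuous hζc hε.le hθ hA0 hρ (k - j) j k
      (by omega) (fun p hp ↦ hc p (by omega)) hg hgc y hAg).trans_eq ?_
    have h2 : ε ^ (k + θ - j : ℝ) = ε ^ (k - j) * ε ^ θ := by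
      rw [← Real.rpow_natCast ε (k - j), ← Real.rpow_add hε, Nat.cast_sub hj]; ring_nf
    rw [h2, Real.mul_rpow hε.le hρ0, mul_pow]
    ring
  · beta_reduce
    rw [if_neg (by omega)]
    refine norm_le_of_forall_mem_open (Ω := Ω) Metric.isOpen_ball
      (hFs.continuous_iteratedFDeriv (by exact_mod_cast le_top)).continuousOn (fun y hy ↦ ?_) x hx
    obtain ⟨g, hg, hgc, hfg, hFg, hAg⟩ := main y hy
    obtain ⟨l, rfl⟩ : ∃ l, j = k + l := ⟨j - k, by omega⟩
    rw [(hFg.iteratedFDeriv ℝ (k + l)).eq_of_nhds, Nat.add_sub_cancel_left]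
    refine (norm_iteratedFDeriv_mollifyTail_le c (k + 1) hζ hζc hε hθ hA0 hρ0 hρ l k (by omega)
      hg hgc y hAg).trans_eq ?_
    have h2 : ε ^ (k + θ - (k + l : ℕ) : ℝ) = ε ^ θ * ε⁻¹ ^ l := by
      rw [inv_pow, ← Real.rpow_natCast ε l, ← Real.rpow_neg hε.le, ← Real.rpow_add hε]
      push_cast
      ring_nf
    rw [h2]
    ring

end LocalSmoothing

section BoundaryCorrection

variable {E : Type} [NormedAddCommGroup E] [NormedSpace ℝ E]

theorem mem_frontier_iff_of_sublevel {Ω U : Set E} (hΩ : IsOpen Ω) {φ : E → ℝ} (hU : IsOpen U)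
    (hφ : Continuous φ) (hd : ∀ y ∈ U, fderiv ℝ φ y ≠ 0) (h : Ω ∩ U = {y ∈ U | φ y < 0}) {y : E}
    (hy : y ∈ U) : y ∈ frontier Ω ↔ φ y = 0 := by
  have hiff : ∀ z ∈ U, z ∈ Ω ↔ φ z < 0 := fun z hz ↦ by
    have := Set.ext_iff.1 h z
    simpa [hz] using this
  rw [hΩ.frontier_eq]
  constructor
  · rintro ⟨h1, h2⟩
    refine le_antisymm (nonpos_of_mem_closure hU hφ h h1 hy) ?_
    rw [hiff y hy] at h2
    exact not_lt.1 h2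
  · intro h0
    refine ⟨?_, by rw [hiff y hy, h0]; exact lt_irrefl _⟩
    by_contra hcl
    refine hd y hy (IsLocalMin.fderiv_eq_zero ?_)
    filter_upwards [hU.mem_nhds hy, isClosed_closure.isOpen_compl.mem_nhds hcl] with z hz hzc
    rw [h0]
    exact not_lt.1 fun hlt ↦ hzc (subset_closure ((hiff z hz).2 hlt))

theorem exists_retraction_frontier [CompleteSpace E] {Ω U : Set E} (hΩ : IsOpen Ω) {φ : E → ℝ}
    (hU : IsOpen U) (hφ : ContDiff ℝ ∞ φ) (hd : ∀ y ∈ U, fderiv ℝ φ y ≠ 0)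
    (h : Ω ∩ U = {y ∈ U | φ y < 0}) {x₀ : E} (hx₀ : x₀ ∈ U) (hxf : x₀ ∈ frontier Ω) {r : ℝ}
    (hr : 0 < r) (N : ℕ) :
    ∃ V, IsOpen V ∧ x₀ ∈ V ∧ V ⊆ Metric.ball x₀ r ∧ ∃ π : E → E, ContDiffOn ℝ N π V ∧
      (∀ x ∈ V, π x ∈ frontier Ω ∧ π x ∈ Metric.ball x₀ r) ∧ (∀ x ∈ V ∩ frontier Ω, π x = x) ∧
      ∃ P, 1 ≤ P ∧ ∀ x ∈ V, ∀ i ≤ N, ‖iteratedFDeriv ℝ i π x‖ ≤ P := by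
  have hmem := fun y (hy : y ∈ U) ↦ mem_frontier_iff_of_sublevel hΩ hU hφ.continuous hd h hy
  obtain ⟨v, hv⟩ := ContinuousLinearMap.exists_apply_neg (hd x₀ hx₀)
  set ℓ := fderiv ℝ φ x₀ with hℓ
  set w : E := (ℓ v)⁻¹ • v with hw
  have hℓw : ℓ w = 1 := by simp [hw, hv.ne]
  set Ψ : E → E := fun x ↦ x + (φ x - ℓ x) • w with hΨ
  have hΨs : ContDiff ℝ ∞ Ψ := contDiff_id.add ((hφ.sub ℓ.contDiff).smul contDiff_const)
  have hΨd : HasFDerivAt Ψ ((ContinuousLinearEquiv.refl ℝ E : E ≃L[ℝ] E) : E →L[ℝ] E) x₀ := by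
    have h1 := (hasFDerivAt_id (𝕜 := ℝ) x₀).add
      ((((hφ.differentiable (by simp)) x₀).hasFDerivAt.sub ℓ.hasFDerivAt).smul_const w)
    refine h1.congr_fderiv ?_
    ext z
    simp [← hℓ]
  have hℓΨ : ∀ x, ℓ (Ψ x) = φ x := fun x ↦ by simp [hΨ, hℓw]
  have hn : (((N + 1 : ℕ)) : WithTop ℕ∞) ≠ 0 := by norm_cast
  have hΨN : ContDiffAt ℝ ((N + 1 : ℕ) : WithTop ℕ∞) Ψ x₀ :=
    (hΨs.of_le (by exact_mod_cast le_top)).contDiffAt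
  set e := hΨN.toOpenPartialHomeomorph Ψ hΨd hn with he
  have hesrc : x₀ ∈ e.source := hΨN.mem_toOpenPartialHomeomorph_source hΨd hn
  have hecoe : ∀ x, e x = Ψ x := fun x ↦ rfl
  have hsymm : ContDiffAt ℝ ((N + 1 : ℕ) : WithTop ℕ∞) e.symm (Ψ x₀) :=
    hΨN.to_localInverse hΨd hn
  have hφ0 : φ x₀ = 0 := (hmem x₀ hx₀).1 hxf
  set q : E → E := fun x ↦ Ψ x - φ x • w with hq
  have hqs : ContDiff ℝ ∞ q := hΨs.sub (hφ.smul contDiff_const)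
  have hq0 : q x₀ = Ψ x₀ := by simp [hq, hφ0]
  set π : E → E := fun x ↦ e.symm (q x) with hπ
  have hπ0 : π x₀ = x₀ := by
    simp only [hπ]
    rw [hq0]
    exact e.left_inv hesrc
  have hπs : ContDiffAt ℝ ((N + 1 : ℕ) : WithTop ℕ∞) π x₀ :=
    ContDiffAt.comp x₀ (by rw [hq0]; exact hsymm) (hqs.of_le (by exact_mod_cast le_top)).contDiffAt
  have hN : ((N : ℕ) : WithTop ℕ∞) ≤ ((N + 1 : ℕ) : WithTop ℕ∞) := by norm_cast; omega
  have hπt : Tendsto π (𝓝 x₀) (𝓝 x₀) := by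
    have := hπs.continuousAt.tendsto
    rwa [hπ0] at this
  set P : ℝ := 1 + ∑ i ∈ Finset.range (N + 1), ‖iteratedFDeriv ℝ i π x₀‖ with hP
  have hS0 : 0 ≤ ∑ i ∈ Finset.range (N + 1), ‖iteratedFDeriv ℝ i π x₀‖ :=
    Finset.sum_nonneg fun _ _ ↦ norm_nonneg _
  have ev1 : ∀ᶠ x in 𝓝 x₀, ∀ i ∈ Finset.range (N + 1), ‖iteratedFDeriv ℝ i π x‖ < P := by
    refine (Filter.eventually_all_finset _).2 fun i hi ↦ ?_
    have hc : ContinuousAt (iteratedFDeriv ℝ i π) x₀ := hπs.continuousAt_iteratedFDeriv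
      (by have := Finset.mem_range.1 hi; norm_cast; omega)
    refine hc.norm.eventually_lt continuousAt_const ?_
    have := Finset.single_le_sum (f := fun i ↦ ‖iteratedFDeriv ℝ i π x₀‖)
      (fun _ _ ↦ norm_nonneg _) hi
    linarith
  have ev2 : ∀ᶠ x in 𝓝 x₀, ContDiffAt ℝ ((N + 1 : ℕ) : WithTop ℕ∞) π x :=
    hπs.eventually (by exact_mod_cast WithTop.coe_ne_top)
  have ev3 : ∀ᶠ x in 𝓝 x₀, x ∈ e.source := e.open_source.mem_nhds hesrc
  have ev4 : ∀ᶠ x in 𝓝 x₀, q x ∈ e.target :=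
    hqs.continuous.continuousAt.eventually_mem (e.open_target.mem_nhds
      (by rw [hq0]; exact e.map_source hesrc))
  have ev5 : ∀ᶠ x in 𝓝 x₀, π x ∈ U ∩ Metric.ball x₀ r :=
    hπt.eventually (inter_mem (hU.mem_nhds hx₀) (Metric.ball_mem_nhds _ hr))
  obtain ⟨V, hVsub, hVo, hxV⟩ := mem_nhds_iff.1 (ev1.and (ev2.and (ev3.and (ev4.and
    (ev5.and (inter_mem (hU.mem_nhds hx₀) (Metric.ball_mem_nhds x₀ hr)))))))
  refine ⟨V, hVo, hxV, fun x hx ↦ (hVsub hx).2.2.2.2.2.2, π,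
    fun x hx ↦ ((hVsub hx).2.1.of_le hN).contDiffWithinAt, fun x hx ↦ ?_, ?_, P, by linarith,
    fun x hx i hi ↦ ((hVsub hx).1 i (Finset.mem_range.2 (by omega))).le⟩
  · obtain ⟨-, -, -, hx4, hx5, -⟩ := hVsub hx
    refine ⟨(hmem _ hx5.1).2 ?_, hx5.2⟩
    have h1 : Ψ (π x) = q x := e.right_inv hx4
    rw [← hℓΨ, h1]
    simp [hq, hℓΨ, hℓw]
  · rintro x ⟨hx, hxf⟩
    obtain ⟨-, -, hx3, -, -, hx6⟩ := hVsub hx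
    have h1 : q x = Ψ x := by simp [hq, (hmem x hx6.1).1 hxf]
    simp only [hπ]
    rw [h1]
    exact e.left_inv hx3

/-- `f` is of class `C^k` on `K` with derivatives bounded by `A`, and the derivative of order `k`
is `θ`-Hölder with constant `A`. -/
def HolderBound (K : Set E) (k : ℕ) (θ A : ℝ) (f : E → ℝ) : Prop :=
  ContDiffOn ℝ k f K ∧ (∀ j ≤ k, ∀ x ∈ K, ‖iteratedFDerivWithin ℝ j f K x‖ ≤ A) ∧
    ∀ x ∈ K, ∀ y ∈ K,
      ‖iteratedFDerivWithin ℝ k f K x - iteratedFDerivWithin ℝ k f K y‖ ≤ A * ‖x - y‖ ^ θ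

/-- Functions of class `C^{k+θ}` on the closure of `Ω` vanishing on the boundary can be
approximated on `V`, at every small scale `ε`, by functions of class `C^N` vanishing on the
boundary. -/
def HasApprox (Ω V : Set E) (k N : ℕ) (θ : ℝ) : Prop :=
  ∃ C ≥ 0, ∃ ε₀ > 0, ε₀ ≤ 1 ∧ ∀ (f : E → ℝ) (A ε : ℝ), 0 ≤ A → 0 < ε → ε ≤ ε₀ →
    HolderBound (closure Ω) k θ A f → (∀ x ∈ frontier Ω, f x = 0) →
    ∃ F : E → ℝ, ContDiffOn ℝ N F V ∧ (∀ x ∈ V ∩ frontier Ω, F x = 0) ∧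
      ∀ x ∈ V ∩ closure Ω,
        (∀ j ≤ k, ‖iteratedFDerivWithin ℝ j (f - F) (closure Ω) x‖
          ≤ C * A * ε ^ (k + θ - j : ℝ)) ∧
        (∀ j, k < j → j ≤ N → ‖iteratedFDeriv ℝ j F x‖ ≤ C * A * ε ^ (k + θ - j : ℝ))

variable [FiniteDimensional ℝ E] [MeasureSpace E] [BorelSpace E]
  [(volume : Measure E).IsAddHaarMeasure]

theorem hasApprox_of_mem {Ω : Set E} (hΩ : IsOpen Ω) (hK : IsCompact (closure Ω))
    (hud : UniqueDiffOn ℝ (closure Ω)) {x₀ : E} (hx₀ : x₀ ∈ Ω) (k N : ℕ) {θ : ℝ} (hθ : 0 ≤ θ) :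
    ∃ V, IsOpen V ∧ x₀ ∈ V ∧ HasApprox Ω V k N θ := by
  obtain ⟨r, hcone⟩ := exists_hasConeAt_of_mem hΩ hx₀
  obtain ⟨C, hC, ε₀, hε₀, H⟩ := exists_smooth_approx_of_cone hΩ hK hud hcone k hθ
  have hCle : ∀ j ≤ k + N, C j ≤ ∑ j ∈ Finset.range (k + N + 1), C j := fun j hj ↦
    Finset.single_le_sum (fun i _ ↦ hC i) (Finset.mem_range.2 (by omega))
  refine ⟨Ω ∩ Metric.ball x₀ r, hΩ.inter Metric.isOpen_ball, ⟨hx₀, Metric.mem_ball_self hcone.2.1⟩,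
    ∑ j ∈ Finset.range (k + N + 1), C j, Finset.sum_nonneg fun i _ ↦ hC i, min ε₀ 1,
    lt_min hε₀ one_pos, min_le_right _ _, fun f A ε hA hε hεle hf hf0 ↦ ?_⟩
  obtain ⟨F, hF, hb⟩ := H f A ε hA hε (hεle.trans (min_le_left _ _)) hf.1 hf.2.2
  refine ⟨F, (hF.of_le (by exact_mod_cast le_top)).contDiffOn, ?_, fun x hx ↦ ⟨fun j hj ↦ ?_,
    fun j hj hjN ↦ ?_⟩⟩
  · rintro x ⟨⟨hx, -⟩, hxf⟩
    rw [hΩ.frontier_eq] at hxf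
    exact (hxf.2 hx).elim
  · refine ((hb x ⟨hx.2, hx.1.2⟩).1 j hj).trans ?_
    gcongr
    exact hCle j (by omega)
  · refine ((hb x ⟨hx.2, hx.1.2⟩).2 j hj).trans ?_
    gcongr
    exact hCle j (by omega)

theorem hasApprox_of_frontier {Ω U : Set E} (hΩ : IsOpen Ω) (hK : IsCompact (closure Ω))
    (hud : UniqueDiffOn ℝ (closure Ω)) {φ : E → ℝ} (hU : IsOpen U) (hφ : ContDiff ℝ ∞ φ)
    (hd : ∀ y ∈ U, fderiv ℝ φ y ≠ 0) (h : Ω ∩ U = {y ∈ U | φ y < 0}) {x₀ : E} (hx₀ : x₀ ∈ U)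
    (hxf : x₀ ∈ frontier Ω) (k N : ℕ) (hkN : k ≤ N) {θ : ℝ} (hθ : 0 ≤ θ) (hθ1 : θ < 1) :
    ∃ V, IsOpen V ∧ x₀ ∈ V ∧ HasApprox Ω V k N θ := by
  have : CompleteSpace E := FiniteDimensional.complete ℝ E
  obtain ⟨ν, δ, r, hcone⟩ := exists_hasConeAt_of_frontier hU hφ h hx₀ (hd x₀ hx₀)
  obtain ⟨C', hC', ε₀, hε₀, H⟩ := exists_smooth_approx_of_cone hΩ hK hud hcone k hθ
  obtain ⟨V, hV, hxV, hVr, π, hπ, hπf, hπid, P, hP1, hP⟩ :=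
    exists_retraction_frontier hΩ hU hφ hd h hx₀ hxf hcone.2.1 N
  set C := ∑ j ∈ Finset.range (N + 1), C' j with hCdef
  have hC0 : 0 ≤ C := Finset.sum_nonneg fun i _ ↦ hC' i
  have hCle : ∀ j ≤ N, C' j ≤ C := fun j hj ↦
    Finset.single_le_sum (fun i _ ↦ hC' i) (Finset.mem_range.2 (by omega))
  set D := (N.factorial : ℝ) * P ^ N with hDdef
  have hP0 : 0 ≤ P := zero_le_one.trans hP1
  have hD : ∀ j ≤ N, (j.factorial : ℝ) * P ^ j ≤ D := fun j hj ↦ by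
    rw [hDdef]
    gcongr
  refine ⟨V, hV, hxV, C + D * (1 + C), by positivity, min ε₀ 1, lt_min hε₀ one_pos,
    min_le_right _ _, fun f A ε hA hε hεle hf hf0 ↦ ?_⟩
  have hε1 : ε ≤ 1 := hεle.trans (min_le_right _ _)
  obtain ⟨F, hF, hb⟩ := H f A ε hA hε (hεle.trans (min_le_left _ _)) hf.1 hf.2.2
  have hFN : ∀ n : ℕ, ContDiff ℝ n F := fun n ↦ hF.of_le (by exact_mod_cast le_top)
  have hb1 : ∀ x ∈ closure Ω ∩ Metric.ball x₀ r, ∀ j ≤ k,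
      ‖iteratedFDerivWithin ℝ j (f - F) (closure Ω) x‖ ≤ C * A * ε ^ (k + θ - j : ℝ) :=
    fun x hx j hj ↦ ((hb x hx).1 j hj).trans (by gcongr; exact hCle j (by omega))
  have hb2 : ∀ x ∈ closure Ω ∩ Metric.ball x₀ r, ∀ j, k < j → j ≤ N →
      ‖iteratedFDeriv ℝ j F x‖ ≤ C * A * ε ^ (k + θ - j : ℝ) :=
    fun x hx j hj hjN ↦ ((hb x hx).2 j hj).trans (by gcongr; exact hCle j hjN)
  have hpow : ∀ i j : ℕ, i ≤ j → ε ^ (k + θ - i : ℝ) ≤ ε ^ (k + θ - j : ℝ) := fun i j hij ↦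
    Real.rpow_le_rpow_of_exponent_ge hε hε1 (by gcongr)
  have hπK : MapsTo π V (closure Ω) := fun x hx ↦ frontier_subset_closure (hπf x hx).1
  have hπm : ∀ x ∈ V, π x ∈ closure Ω ∩ Metric.ball x₀ r := fun x hx ↦ ⟨hπK hx, (hπf x hx).2⟩
  have hπP : ∀ n ≤ N, ∀ x ∈ V, ∀ i, 1 ≤ i → i ≤ n → ‖iteratedFDerivWithin ℝ i π V x‖ ≤ P ^ i :=
    fun n hn x hx i h1 hi ↦ by
      rw [iteratedFDerivWithin_of_isOpen i hV hx]
      exact (hP x hx i (hi.trans hn)).trans (le_self_pow₀ hP1 (by omega))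
  have hFπ : ContDiffOn ℝ N (F ∘ π) V := (hFN N).comp_contDiffOn hπ
  have hcomp1 : ∀ x ∈ V, ∀ j ≤ k, ‖iteratedFDeriv ℝ j (F ∘ π) x‖
      ≤ D * (1 + C) * A * ε ^ (k + θ - j : ℝ) := by
    intro x hx j hj
    have hfF : ContDiffOn ℝ k (f - F) (closure Ω) := hf.1.sub (hFN k).contDiffOn
    have h1 : EqOn (F ∘ π) (-((f - F) ∘ π)) V := fun y hy ↦ by
      simp [hf0 _ (hπf y hy).1]
    rw [← iteratedFDerivWithin_of_isOpen j hV hx, iteratedFDerivWithin_congr h1 hx,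
      iteratedFDerivWithin_neg_apply hV.uniqueDiffOn hx, norm_neg]
    refine (norm_iteratedFDerivWithin_comp_le hfF (hπ.of_le (by exact_mod_cast hkN))
      (by exact_mod_cast hj) hud hV.uniqueDiffOn hπK hx (C := C * A * ε ^ (k + θ - j : ℝ)) (D := P)
      (fun i hi ↦ (hb1 _ (hπm x hx) i (hi.trans hj)).trans ?_)
      (hπP j (hj.trans hkN) x hx)).trans ?_
    · gcongr ?_ * ?_
      exact hpow i j hi
    · calc (j.factorial : ℝ) * (C * A * ε ^ (k + θ - j : ℝ)) * P ^ j
          = (j.factorial * P ^ j) * C * A * ε ^ (k + θ - j : ℝ) := by ring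
        _ ≤ D * (1 + C) * A * ε ^ (k + θ - j : ℝ) := by
          gcongr
          · exact hD j (hj.trans hkN)
          · linarith
  have hcomp2 : ∀ x ∈ V, ∀ j, k < j → j ≤ N → ‖iteratedFDeriv ℝ j (F ∘ π) x‖
      ≤ D * (1 + C) * A * ε ^ (k + θ - j : ℝ) := by
    intro x hx j hkj hjN
    have hone : 1 ≤ ε ^ (k + θ - j : ℝ) := by
      refine Real.one_le_rpow_of_pos_of_le_one_of_nonpos hε hε1 ?_
      have : (k + 1 : ℝ) ≤ j := by exact_mod_cast hkj
      linarith
    rw [← iteratedFDerivWithin_of_isOpen j hV hx]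
    refine (norm_iteratedFDerivWithin_comp_le (hFN N).contDiffOn hπ
      (by exact_mod_cast hjN) hud hV.uniqueDiffOn hπK hx
      (C := (1 + C) * A * ε ^ (k + θ - j : ℝ)) (D := P)
      (fun i hi ↦ ?_) (hπP j hjN x hx)).trans ?_
    · have hy := hπm x hx
      by_cases hik : i ≤ k
      · have h1 : F = f - (f - F) := by simp
        have hcf : ContDiffWithinAt ℝ i f (closure Ω) (π x) :=
          (hf.1.of_le (by exact_mod_cast hik)) _ hy.1
        have hcfF : ContDiffWithinAt ℝ i (f - F) (closure Ω) (π x) :=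
          hcf.sub (hFN i).contDiffAt.contDiffWithinAt
        rw [h1, iteratedFDerivWithin_sub_apply hcf hcfF hud hy.1]
        calc _ ≤ A + C * A * ε ^ (k + θ - i : ℝ) :=
              (norm_sub_le _ _).trans (add_le_add (hf.2.1 i hik _ hy.1) (hb1 _ hy i hik))
          _ ≤ A * ε ^ (k + θ - j : ℝ) + C * A * ε ^ (k + θ - j : ℝ) := by
              refine add_le_add (le_mul_of_one_le_right hA hone) ?_
              gcongr ?_ * ?_
              exact hpow i j hi
          _ = _ := by ring
      · rw [iteratedFDerivWithin_eq_iteratedFDeriv hud (hFN i).contDiffAt hy.1]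
        calc _ ≤ C * A * ε ^ (k + θ - i : ℝ) := hb2 _ hy i (by omega) (hi.trans hjN)
          _ ≤ (1 + C) * A * ε ^ (k + θ - j : ℝ) := by
              gcongr ?_ * _ * ?_
              · linarith
              · exact hpow i j hi
    · calc (j.factorial : ℝ) * ((1 + C) * A * ε ^ (k + θ - j : ℝ)) * P ^ j
          = (j.factorial * P ^ j) * (1 + C) * A * ε ^ (k + θ - j : ℝ) := by ring
        _ ≤ D * (1 + C) * A * ε ^ (k + θ - j : ℝ) := by
          gcongr
          exact hD j hjN
  refine ⟨F - F ∘ π, (hFN N).contDiffOn.sub hFπ, fun x hx ↦ by simp [hπid x hx],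
    fun x hx ↦ ⟨fun j hj ↦ ?_, fun j hj hjN ↦ ?_⟩⟩
  · have hFπx : ContDiffAt ℝ j (F ∘ π) x :=
      (hFπ.contDiffAt (hV.mem_nhds hx.1)).of_le (by exact_mod_cast hj.trans hkN)
    have hfF : ContDiffWithinAt ℝ j (f - F) (closure Ω) x :=
      ((hf.1.of_le (by exact_mod_cast hj)) x hx.2).sub (hFN j).contDiffAt.contDiffWithinAt
    have h1 : f - (F - F ∘ π) = (f - F) + F ∘ π := by abel
    rw [h1, iteratedFDerivWithin_add_apply hfF hFπx.contDiffWithinAt hud hx.2,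
      iteratedFDerivWithin_eq_iteratedFDeriv hud hFπx hx.2]
    calc _ ≤ C * A * ε ^ (k + θ - j : ℝ) + D * (1 + C) * A * ε ^ (k + θ - j : ℝ) :=
          (norm_add_le _ _).trans (add_le_add (hb1 x ⟨hx.2, hVr hx.1⟩ j hj) (hcomp1 x hx.1 j hj))
      _ = _ := by ring
  · have hFπx : ContDiffAt ℝ j (F ∘ π) x :=
      (hFπ.contDiffAt (hV.mem_nhds hx.1)).of_le (by exact_mod_cast hjN)
    rw [iteratedFDeriv_sub_apply (hFN j).contDiffAt hFπx]
    calc _ ≤ C * A * ε ^ (k + θ - j : ℝ) + D * (1 + C) * A * ε ^ (k + θ - j : ℝ) :=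
          (norm_sub_le _ _).trans
            (add_le_add (hb2 x ⟨hx.2, hVr hx.1⟩ j hj hjN) (hcomp2 x hx.1 j hj hjN))
      _ = _ := by ring

end BoundaryCorrection

section Gluing

variable {E : Type} [NormedAddCommGroup E] [NormedSpace ℝ E]

theorem norm_iteratedFDerivWithin_mul_le_of_le {s : Set E} {χ g : E → ℝ} {n : ℕ} {x : E}
    (hχ : ContDiffOn ℝ n χ s) (hg : ContDiffOn ℝ n g s) (hs : UniqueDiffOn ℝ s) (hx : x ∈ s)
    {X Y : ℝ} (hX : ∀ i ≤ n, ‖iteratedFDerivWithin ℝ i χ s x‖ ≤ X)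
    (hY : ∀ i ≤ n, ‖iteratedFDerivWithin ℝ i g s x‖ ≤ Y) :
    ‖iteratedFDerivWithin ℝ n (χ * g) s x‖ ≤ 2 ^ n * X * Y := by
  have hX0 : 0 ≤ X := (norm_nonneg _).trans (hX 0 (Nat.zero_le _))
  refine (norm_iteratedFDerivWithin_mul_le hχ hg hs hx le_rfl).trans ?_
  calc ∑ i ∈ Finset.range (n + 1), (n.choose i : ℝ) * ‖iteratedFDerivWithin ℝ i χ s x‖
        * ‖iteratedFDerivWithin ℝ (n - i) g s x‖
      ≤ ∑ i ∈ Finset.range (n + 1), (n.choose i : ℝ) * X * Y := by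
        refine Finset.sum_le_sum fun i hi ↦ ?_
        have hi' : i ≤ n := Nat.lt_succ_iff.1 (Finset.mem_range.1 hi)
        gcongr
        · exact hX i hi'
        · exact hY _ (Nat.sub_le _ _)
    _ = 2 ^ n * X * Y := by
        rw [← Finset.sum_mul, ← Finset.sum_mul]
        congr 2
        exact_mod_cast Nat.sum_range_choose n

theorem HasApprox.exists_mul {Ω V : Set E} {k N : ℕ} {θ : ℝ} (h : HasApprox Ω V k N θ)
    (hK : IsCompact (closure Ω)) (hud : UniqueDiffOn ℝ (closure Ω)) (hV : IsOpen V)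
    (hθ1 : θ < 1)
    (hkN : k ≤ N) {χ : E → ℝ} (hχ : ContDiff ℝ ∞ χ) (hχV : tsupport χ ⊆ V) :
    ∃ C ≥ 0, ∃ ε₀ > 0, ε₀ ≤ 1 ∧ ∀ f A ε, 0 ≤ A → 0 < ε → ε ≤ ε₀ →
      HolderBound (closure Ω) k θ A f → (∀ x ∈ frontier Ω, f x = 0) →
      ∃ G : E → ℝ, ContDiff ℝ N G ∧ (∀ x ∈ frontier Ω, G x = 0) ∧ ∀ x ∈ closure Ω,
        (∀ j ≤ k, ‖iteratedFDerivWithin ℝ j (χ * f - G) (closure Ω) x‖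
          ≤ C * A * ε ^ (k + θ - j : ℝ)) ∧
        (∀ j, k < j → j ≤ N → ‖iteratedFDeriv ℝ j G x‖ ≤ C * A * ε ^ (k + θ - j : ℝ)) := by
  obtain ⟨C, hC, ε₀, hε₀, hε₀1, H⟩ := h
  have hχN : ∀ n : ℕ, ContDiff ℝ n χ := fun n ↦ hχ.of_le (by exact_mod_cast le_top)
  have hbd : ∃ X ≥ 0, ∀ i ≤ N, ∀ x ∈ closure Ω, ‖iteratedFDeriv ℝ i χ x‖ ≤ X := by
    have h1 : ∀ i : ℕ, ∃ X, ∀ x ∈ closure Ω, ‖iteratedFDeriv ℝ i χ x‖ ≤ X := fun i ↦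
      hK.exists_bound_of_continuousOn ((hχN i).continuous_iteratedFDeriv le_rfl).continuousOn
    choose X hX using h1
    refine ⟨∑ i ∈ Finset.range (N + 1), |X i|, by positivity, fun i hi x hx ↦ ?_⟩
    exact ((hX i x hx).trans (le_abs_self _)).trans
      (Finset.single_le_sum (f := fun i ↦ |X i|) (fun _ _ ↦ abs_nonneg _)
        (Finset.mem_range.2 (Nat.lt_succ_of_le hi)))
  obtain ⟨X, hX0, hX⟩ := hbd
  refine ⟨2 ^ N * X * (1 + C), by positivity, ε₀, hε₀, hε₀1, fun f A ε hA hε hεε hf hf0 ↦ ?_⟩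
  have hε1 : ε ≤ 1 := hεε.trans hε₀1
  have hpow : ∀ i j : ℕ, i ≤ j → ε ^ (k + θ - i : ℝ) ≤ ε ^ (k + θ - j : ℝ) := fun i j hij ↦ by
    refine Real.rpow_le_rpow_of_exponent_ge hε hε1 ?_
    have : (i : ℝ) ≤ j := by exact_mod_cast hij
    linarith
  obtain ⟨F, hF, hF0, hb⟩ := H f A ε hA hε hεε hf hf0
  have hFloc : ∀ x, x ∈ V → ContDiffAt ℝ N F x := fun x hx ↦ hF.contDiffAt (hV.mem_nhds hx)
  have hzero : ∀ x, x ∉ tsupport χ → χ =ᶠ[𝓝 x] 0 := fun x hx ↦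
    notMem_tsupport_iff_eventuallyEq.1 hx
  have h2 : ∀ {j : ℕ}, j ≤ N → (2 : ℝ) ^ j ≤ 2 ^ N := fun hj ↦
    pow_le_pow_right₀ (by norm_num) hj
  refine ⟨χ * F, ?_, fun x hx ↦ ?_, fun x hx ↦ ⟨fun j hj ↦ ?_, fun j hj hjN ↦ ?_⟩⟩
  · rw [contDiff_iff_contDiffAt]
    intro x
    by_cases hxs : x ∈ tsupport χ
    · exact (hχN N).contDiffAt.mul (hFloc x (hχV hxs))
    · refine (contDiffAt_const (c := (0 : ℝ))).congr_of_eventuallyEq ?_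
      filter_upwards [hzero x hxs] with y hy
      simp [hy]
  · by_cases hxs : x ∈ tsupport χ
    · simp [hF0 x ⟨hχV hxs, hx⟩]
    · simp [image_eq_zero_of_notMem_tsupport hxs]
  · by_cases hxs : x ∈ tsupport χ
    · have hxV := hχV hxs
      have hKV : (closure Ω ∩ V : Set E) =ᶠ[𝓝 x] closure Ω := by
        filter_upwards [hV.mem_nhds hxV] with y hy
        exact propext ⟨fun h ↦ h.1, fun h ↦ ⟨h, hy⟩⟩
      have hudV : UniqueDiffOn ℝ (closure Ω ∩ V) := hud.inter hV
      rw [← mul_sub, ← iteratedFDerivWithin_congr_set hKV]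
      refine (norm_iteratedFDerivWithin_mul_le_of_le (X := X) (Y := C * A * ε ^ (k + θ - j : ℝ))
        (hχN j).contDiffOn ?_ hudV ⟨hx, hxV⟩ (fun i hi ↦ ?_) (fun i hi ↦ ?_)).trans ?_
      · exact ((hf.1.of_le (by exact_mod_cast hj)).mono inter_subset_left).sub
          ((hF.of_le (by exact_mod_cast hj.trans hkN)).mono inter_subset_right)
      · rw [iteratedFDerivWithin_eq_iteratedFDeriv hudV (hχN i).contDiffAt ⟨hx, hxV⟩]
        exact hX i (hi.trans (hj.trans hkN)) x hx
      · rw [iteratedFDerivWithin_congr_set hKV]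
        refine ((hb x ⟨hxV, hx⟩).1 i (hi.trans hj)).trans ?_
        gcongr ?_ * ?_
        exact hpow i j hi
      · calc 2 ^ j * X * (C * A * ε ^ (k + θ - j : ℝ))
            ≤ 2 ^ N * X * ((1 + C) * A * ε ^ (k + θ - j : ℝ)) := by
              gcongr ?_ * _ * (?_ * _ * _)
              · exact h2 (hj.trans hkN)
              · linarith
          _ = _ := by ring
    · have : χ * f - χ * F =ᶠ[𝓝 x] 0 := by
        filter_upwards [hzero x hxs] with y hy
        simp [hy]
      rw [(this.filter_mono nhdsWithin_le_nhds).iteratedFDerivWithin_eq this.eq_of_nhds]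
      simp only [Pi.zero_def, iteratedFDerivWithin_fun_zero, Pi.zero_apply, norm_zero]
      positivity
  · by_cases hxs : x ∈ tsupport χ
    · have hxV := hχV hxs
      have hone : 1 ≤ ε ^ (k + θ - j : ℝ) := by
        refine Real.one_le_rpow_of_pos_of_le_one_of_nonpos hε hε1 ?_
        have : (k + 1 : ℝ) ≤ j := by exact_mod_cast hj
        linarith
      rw [← iteratedFDerivWithin_of_isOpen j hV hxV]
      refine (norm_iteratedFDerivWithin_mul_le_of_le (X := X)
        (Y := (1 + C) * A * ε ^ (k + θ - j : ℝ))
        (hχN j).contDiffOn (hF.of_le (by exact_mod_cast hjN)) hV.uniqueDiffOn hxV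
        (fun i hi ↦ ?_) (fun i hi ↦ ?_)).trans ?_
      · rw [iteratedFDerivWithin_of_isOpen i hV hxV]
        exact hX i (hi.trans hjN) x hx
      · rw [iteratedFDerivWithin_of_isOpen i hV hxV]
        by_cases hik : i ≤ k
        · have h1 : F = f - (f - F) := by simp
          have hFi : ContDiffAt ℝ i F x := (hFloc x hxV).of_le (by exact_mod_cast hi.trans hjN)
          have hcf : ContDiffWithinAt ℝ i f (closure Ω) x :=
            (hf.1.of_le (by exact_mod_cast hik)) _ hx
          have hcfF : ContDiffWithinAt ℝ i (f - F) (closure Ω) x :=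
            hcf.sub hFi.contDiffWithinAt
          rw [← iteratedFDerivWithin_eq_iteratedFDeriv hud hFi hx, h1,
            iteratedFDerivWithin_sub_apply hcf hcfF hud hx]
          calc _ ≤ A + C * A * ε ^ (k + θ - i : ℝ) :=
                (norm_sub_le _ _).trans
                  (add_le_add (hf.2.1 i hik _ hx) ((hb x ⟨hxV, hx⟩).1 i hik))
            _ ≤ A * ε ^ (k + θ - j : ℝ) + C * A * ε ^ (k + θ - j : ℝ) := by
                refine add_le_add (le_mul_of_one_le_right hA hone) ?_
                gcongr ?_ * ?_
                exact hpow i j hi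
            _ = _ := by ring
        · calc _ ≤ C * A * ε ^ (k + θ - i : ℝ) :=
                (hb x ⟨hxV, hx⟩).2 i (by omega) (hi.trans hjN)
            _ ≤ (1 + C) * A * ε ^ (k + θ - j : ℝ) := by
                gcongr ?_ * _ * ?_
                · linarith
                · exact hpow i j hi
      · calc 2 ^ j * X * ((1 + C) * A * ε ^ (k + θ - j : ℝ))
            ≤ 2 ^ N * X * ((1 + C) * A * ε ^ (k + θ - j : ℝ)) := by
              gcongr ?_ * _ * _
              exact h2 hjN
          _ = _ := by ring
    · have : χ * F =ᶠ[𝓝 x] 0 := by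
        filter_upwards [hzero x hxs] with y hy
        simp [hy]
      rw [(this.iteratedFDeriv ℝ j).eq_of_nhds]
      simp only [Pi.zero_def, iteratedFDeriv_fun_zero, Pi.zero_apply, norm_zero]
      positivity

open scoped Manifold in
theorem hasApprox_univ [FiniteDimensional ℝ E] {Ω : Set E}
    (hK : IsCompact (closure Ω)) (hud : UniqueDiffOn ℝ (closure Ω)) {k N : ℕ} (hkN : k ≤ N)
    {θ : ℝ} (hθ1 : θ < 1)
    (h : ∀ x ∈ closure Ω, ∃ V, IsOpen V ∧ x ∈ V ∧ HasApprox Ω V k N θ) :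
    HasApprox Ω univ k N θ := by
  choose! V hVo hxV hV using h
  obtain ⟨T, hTK, hT⟩ := hK.elim_nhds_subcover V fun x hx ↦ (hVo x hx).mem_nhds (hxV x hx)
  obtain ⟨ρ, hρ⟩ := SmoothPartitionOfUnity.exists_isSubordinate 𝓘(ℝ, E) hK.isClosed
    (fun i : T ↦ V i) (fun i ↦ hVo _ (hTK _ i.2)) (hT.trans (by
      intro x hx
      simp only [mem_iUnion] at hx ⊢
      obtain ⟨i, hi, hx⟩ := hx
      exact ⟨⟨i, hi⟩, hx⟩))
  have hρd : ∀ i, ContDiff ℝ ∞ (ρ i) := fun i ↦ (ρ i).contMDiff.contDiff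
  choose C hC ε₀ hε₀ hε₀1 H using fun i : T ↦ (hV i (hTK _ i.2)).exists_mul hK hud
    (hVo _ (hTK _ i.2)) hθ1 hkN (hρd i) (hρ i)
  obtain ⟨e, he, he1, hei⟩ : ∃ e > 0, e ≤ 1 ∧ ∀ i, e ≤ ε₀ i := by
    have h1 : ∀ᶠ e in 𝓝[>] (0 : ℝ), ∀ i, e ≤ ε₀ i := eventually_all.2 fun i ↦
      (eventually_le_nhds (hε₀ i)).filter_mono nhdsWithin_le_nhds
    have h2 : ∀ᶠ e in 𝓝[>] (0 : ℝ), e ≤ 1 :=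
      (eventually_le_nhds one_pos).filter_mono nhdsWithin_le_nhds
    obtain ⟨e, ⟨he, he'⟩, he0⟩ := ((h1.and h2).and self_mem_nhdsWithin).exists
    exact ⟨e, he0, he', he⟩
  refine ⟨∑ i, C i, Finset.sum_nonneg fun i _ ↦ hC i, e, he, he1,
    fun f A ε hA hε hεe hf hf0 ↦ ?_⟩
  choose G hG hG0 hb using fun i ↦ H i f A ε hA hε (hεe.trans (hei i)) hf hf0
  have hfk : ∀ j ≤ k, ContDiffOn ℝ j f (closure Ω) := fun j hj ↦
    hf.1.of_le (by exact_mod_cast hj)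
  refine ⟨∑ i, G i, ?_, fun x hx ↦ by simp [hG0 _ x hx.2],
    fun x hx ↦ ⟨fun j hj ↦ ?_, fun j hj hjN ↦ ?_⟩⟩
  · rw [contDiffOn_univ]
    have := ContDiff.sum (s := Finset.univ) fun i _ ↦ hG i
    convert this using 1
    ext x
    simp
  · have hcongr : EqOn (f - ∑ i, G i) (fun y ↦ ∑ i, ((ρ i : E → ℝ) * f - G i) y) (closure Ω) := by
      intro y hy
      have h1 : ∑ i, ρ i y = 1 := by
        rw [← finsum_eq_sum_of_fintype]
        exact ρ.sum_eq_one hy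
      simp only [Pi.sub_apply, Finset.sum_apply, Pi.mul_apply, Finset.sum_sub_distrib,
        ← Finset.sum_mul, h1, one_mul]
    rw [iteratedFDerivWithin_congr hcongr hx.2, iteratedFDerivWithin_fun_sum_apply hud hx.2 ?_]
    · refine (norm_sum_le _ _).trans ?_
      rw [Finset.sum_mul, Finset.sum_mul]
      exact Finset.sum_le_sum fun i _ ↦ (hb i x hx.2).1 j hj
    · intro i _
      exact (((hρd i).of_le (by exact_mod_cast le_top)).contDiffWithinAt.mul (hfk j hj x hx.2)).sub
        ((hG i).of_le (by exact_mod_cast hj.trans hkN)).contDiffWithinAt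
  · rw [iteratedFDeriv_sum_apply (f := G) fun i _ ↦
        ((hG i).of_le (by exact_mod_cast hjN)).contDiffAt,
      Finset.sum_mul, Finset.sum_mul]
    exact (norm_sum_le _ _).trans (Finset.sum_le_sum fun i _ ↦ (hb i x hx.2).2 j hj hjN)

end Gluing

section Interpolation

variable {E : Type} [NormedAddCommGroup E] [NormedSpace ℝ E]

theorem rpow_le_rpow_sub_mul_rpow {d ε a b : ℝ} (hd : 0 ≤ d) (hdε : d ≤ ε) (ha : 0 ≤ a)
    (hab : a ≤ b) : d ^ b ≤ ε ^ (b - a) * d ^ a := by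
  calc d ^ b = d ^ ((b - a) + a) := by ring_nf
    _ = d ^ (b - a) * d ^ a := Real.rpow_add_of_nonneg hd (by linarith) ha
    _ ≤ ε ^ (b - a) * d ^ a := by
      gcongr

theorem rpow_le_rpow_sub_mul_rpow_of_le {d ε a b : ℝ} (hε : 0 < ε) (hdε : ε ≤ d)
    (hab : a ≤ b) : d ^ a ≤ ε ^ (a - b) * d ^ b := by
  calc d ^ a = d ^ ((a - b) + b) := by ring_nf
    _ = d ^ (a - b) * d ^ b := Real.rpow_add (hε.trans_le hdε) _ _
    _ ≤ ε ^ (a - b) * d ^ b := by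
      have hd : 0 < d := hε.trans_le hdε
      refine mul_le_mul_of_nonneg_right ?_ (by positivity)
      exact Real.rpow_le_rpow_of_nonpos hε hdε (by linarith)

/-- A mean value inequality on `K` with constant `M`, for points at distance less than `r₀`. -/
def HasLocalMeanValue (K : Set E) (r₀ M : ℝ) : Prop :=
  ∀ (F : Type) [NormedAddCommGroup F] [NormedSpace ℝ F] (G : E → F) (B : ℝ), 0 ≤ B →
    DifferentiableOn ℝ G K → (∀ x ∈ K, ‖fderivWithin ℝ G K x‖ ≤ B) →
    ∀ x ∈ K, ∀ y ∈ K, ‖x - y‖ < r₀ → ‖G x - G y‖ ≤ M * B * ‖x - y‖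

theorem HasLocalMeanValue.norm_iteratedFDerivWithin_sub_le {K : Set E} {r₀ M : ℝ}
    (h : HasLocalMeanValue K r₀ M) (hud : UniqueDiffOn ℝ K) {g : E → ℝ} {j : ℕ}
    (hg : ContDiffOn ℝ (j + 1 : ℕ) g K) (hM : 0 ≤ M) {B ε θ : ℝ} (hB : 0 ≤ B) (hε : 0 < ε)
    (hεr : ε ≤ r₀)
    (hb : ∀ x ∈ K, ‖iteratedFDerivWithin ℝ (j + 1) g K x‖ ≤ B * ε ^ (-1 : ℝ)) (hθ : 0 ≤ θ)
    (hθ1 : θ ≤ 1) {x y : E} (hx : x ∈ K) (hy : y ∈ K) (hxy : ‖x - y‖ < ε) :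
    ‖iteratedFDerivWithin ℝ j g K x - iteratedFDerivWithin ℝ j g K y‖
      ≤ M * B * ε ^ (-θ) * ‖x - y‖ ^ θ := by
  have h1 := h _ (iteratedFDerivWithin ℝ j g K) (B * ε ^ (-1 : ℝ)) (by positivity)
    (hg.differentiableOn_iteratedFDerivWithin (by exact_mod_cast Nat.lt_succ_self j) hud)
    (fun z hz ↦ by rw [norm_fderivWithin_iteratedFDerivWithin]; exact hb z hz)
    x hx y hy (hxy.trans_le hεr)
  have h2 := rpow_le_rpow_sub_mul_rpow (norm_nonneg (x - y)) hxy.le hθ hθ1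
  rw [Real.rpow_one] at h2
  calc _ ≤ M * (B * ε ^ (-1 : ℝ)) * ‖x - y‖ := h1
    _ ≤ M * (B * ε ^ (-1 : ℝ)) * (ε ^ (1 - θ) * ‖x - y‖ ^ θ) := by gcongr
    _ = M * B * (ε ^ (-1 : ℝ) * ε ^ (1 - θ)) * ‖x - y‖ ^ θ := by ring
    _ = _ := by rw [← Real.rpow_add hε]; ring_nf

theorem norm_sub_le_of_le_norm_sub {F : Type} [NormedAddCommGroup F] {G : E → F} {x y : E}
    {B ε θ : ℝ} (hB : 0 ≤ B) (hx : ‖G x‖ ≤ B) (hy : ‖G y‖ ≤ B) (hε : 0 < ε) (hθ : 0 ≤ θ)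
    (hxy : ε ≤ ‖x - y‖) : ‖G x - G y‖ ≤ 2 * B * ε ^ (-θ) * ‖x - y‖ ^ θ := by
  have h2 := rpow_le_rpow_sub_mul_rpow_of_le hε hxy hθ
  rw [Real.rpow_zero, zero_sub] at h2
  calc _ ≤ 2 * B * 1 := by linarith [norm_sub_le (G x) (G y)]
    _ ≤ 2 * B * (ε ^ (-θ) * ‖x - y‖ ^ θ) := by gcongr
    _ = _ := by ring

/-- The bounds satisfied by the approximations `F` provided by `HasApprox`. -/
def ApproxBound (K : Set E) (k N : ℕ) (θ B ε : ℝ) (f F : E → ℝ) : Prop :=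
  ContDiff ℝ N F ∧ ∀ x ∈ K,
    (∀ j ≤ k, ‖iteratedFDerivWithin ℝ j (f - F) K x‖ ≤ B * ε ^ (k + θ - j : ℝ)) ∧
    (∀ j, k < j → j ≤ N → ‖iteratedFDeriv ℝ j F x‖ ≤ B * ε ^ (k + θ - j : ℝ))

variable {K : Set E} {k N : ℕ} {θ A C ε r₀ M : ℝ} {f F : E → ℝ}

theorem ApproxBound.norm_sub_le_near (h : ApproxBound K k N θ (C * A) ε f F)
    (hL : HasLocalMeanValue K r₀ M)
    (hud : UniqueDiffOn ℝ K) (hM : 0 ≤ M) (hA : 0 ≤ A) (hC : 0 ≤ C) (hε : 0 < ε)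
    (hεr : ε ≤ r₀) {j : ℕ} (hkj : k ≤ j) (hjN : j + 1 ≤ N) {η : ℝ} (hη : 0 ≤ η) (hη1 : η ≤ 1)
    {x y : E} (hx : x ∈ K) (hy : y ∈ K) (hxy : ‖x - y‖ < ε) :
    ‖iteratedFDerivWithin ℝ j F K x - iteratedFDerivWithin ℝ j F K y‖
      ≤ M * C * (A * ε ^ (k + θ - (j + η) : ℝ)) * ‖x - y‖ ^ η := by
  have hF : ContDiff ℝ (j + 1 : ℕ) F := h.1.of_le (by exact_mod_cast hjN)
  have := hL.norm_iteratedFDerivWithin_sub_le hud (g := F) (j := j) hF.contDiffOn hM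
    (B := C * A * ε ^ (k + θ - j : ℝ)) (by positivity) hε hεr (fun z hz ↦ ?_) hη hη1 hx hy hxy
  · refine this.trans_eq ?_
    rw [show (k + θ - (j + η) : ℝ) = (k + θ - j) + (-η) by ring, Real.rpow_add hε]
    ring
  · rw [iteratedFDerivWithin_eq_iteratedFDeriv hud hF.contDiffAt hz, mul_assoc,
      ← Real.rpow_add hε]
    refine ((h.2 z hz).2 (j + 1) (by omega) hjN).trans_eq ?_
    push_cast
    ring_nf

theorem ApproxBound.holderBound_sub (h : ApproxBound K k N θ (C * A) ε f F)
    (hf : HolderBound K k θ A f) (hL : HasLocalMeanValue K r₀ M)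
    (hud : UniqueDiffOn ℝ K) (hM : 0 ≤ M) (hA : 0 ≤ A) (hC : 0 ≤ C) (hε : 0 < ε) (hε1 : ε ≤ 1)
    (hεr : ε ≤ r₀) (hkN : k + 1 ≤ N) (hθ1 : θ < 1) {k₁ : ℕ} {θ₁ : ℝ} (hθ₁ : 0 ≤ θ₁)
    (hθ₁1 : θ₁ < 1) (hlt : (k₁ + θ₁ : ℝ) < k + θ) :
    HolderBound K k₁ θ₁ ((1 + C) * (M + 2) * (A * ε ^ (k + θ - (k₁ + θ₁) : ℝ))) (f - F) := by
  have hk₁ : k₁ ≤ k := by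
    have : (k₁ : ℝ) < (k + 1 : ℕ) := by push_cast; linarith
    exact Nat.lt_succ_iff.1 (by exact_mod_cast this)
  have hcd : ∀ j ≤ k, ContDiffOn ℝ j (f - F) K := fun j hj ↦
    (hf.1.of_le (by exact_mod_cast hj)).sub (h.1.of_le (by exact_mod_cast (by omega))).contDiffOn
  set Y : ℝ := A * ε ^ (k + θ - (k₁ + θ₁) : ℝ) with hY
  have hY0 : 0 ≤ Y := by positivity
  have hCM : 0 ≤ C * M := by positivity
  have hsplit : C * A * ε ^ (k + θ - k₁ : ℝ) * ε ^ (-θ₁) = C * Y := by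
    rw [hY, show (k + θ - (k₁ + θ₁) : ℝ) = (k + θ - k₁) + (-θ₁) by ring, Real.rpow_add hε]
    ring
  refine ⟨hcd k₁ hk₁, fun j hj x hx ↦ ?_, fun x hx y hy ↦ ?_⟩
  · calc _ ≤ C * A * ε ^ (k + θ - j : ℝ) := (h.2 x hx).1 j (hj.trans hk₁)
      _ ≤ C * A * ε ^ (k + θ - (k₁ + θ₁) : ℝ) := by
        refine mul_le_mul_of_nonneg_left ?_ (by positivity)
        refine Real.rpow_le_rpow_of_exponent_ge hε hε1 ?_
        have : (j : ℝ) ≤ k₁ := by exact_mod_cast hj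
        linarith
      _ = C * Y := by rw [hY]; ring
      _ ≤ _ := by
        refine mul_le_mul_of_nonneg_right ?_ hY0
        nlinarith
  · have hd : 0 ≤ ‖x - y‖ ^ θ₁ := by positivity
    rcases lt_or_ge ‖x - y‖ ε with hxy | hxy
    · rcases hk₁.lt_or_eq with hlt' | rfl
      · have := hL.norm_iteratedFDerivWithin_sub_le hud (hcd (k₁ + 1) hlt') hM
          (B := C * A * ε ^ (k + θ - k₁ : ℝ)) (by positivity) hε hεr (fun z hz ↦ ?_) hθ₁ hθ₁1.le
          hx hy hxy
        · refine this.trans ?_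
          refine mul_le_mul_of_nonneg_right ?_ hd
          calc _ = M * (C * A * ε ^ (k + θ - k₁ : ℝ) * ε ^ (-θ₁)) := by ring
            _ = M * C * Y := by rw [hsplit]; ring
            _ ≤ _ := by
              refine mul_le_mul_of_nonneg_right ?_ hY0
              nlinarith
        · rw [mul_assoc, ← Real.rpow_add hε]
          refine ((h.2 z hz).1 (k₁ + 1) hlt').trans_eq ?_
          push_cast
          ring_nf
      · have hθθ : θ₁ < θ := by linarith
        have hsub : ∀ z ∈ K, iteratedFDerivWithin ℝ k₁ (f - F) K z
            = iteratedFDerivWithin ℝ k₁ f K z - iteratedFDerivWithin ℝ k₁ F K z := fun z hz ↦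
          iteratedFDerivWithin_sub_apply (hf.1 z hz)
            (h.1.of_le (by exact_mod_cast (by omega))).contDiffWithinAt hud hz
        have h1 := h.norm_sub_le_near hL hud hM hA hC hε hεr le_rfl hkN hθ₁ hθ₁1.le hx hy hxy
        have h2 := hf.2.2 x hx y hy
        have h3 := rpow_le_rpow_sub_mul_rpow (norm_nonneg (x - y)) hxy.le hθ₁ hθθ.le
        rw [hsub x hx, hsub y hy, sub_sub_sub_comm]
        calc _ ≤ A * ‖x - y‖ ^ θ + M * C * Y * ‖x - y‖ ^ θ₁ :=
              (norm_sub_le _ _).trans (add_le_add h2 h1)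
          _ ≤ A * (ε ^ (θ - θ₁) * ‖x - y‖ ^ θ₁) + M * C * Y * ‖x - y‖ ^ θ₁ := by gcongr
          _ = (1 + M * C) * Y * ‖x - y‖ ^ θ₁ := by
            rw [hY, show (k₁ + θ - (k₁ + θ₁) : ℝ) = θ - θ₁ by ring]
            ring
          _ ≤ _ := by
            refine mul_le_mul_of_nonneg_right (mul_le_mul_of_nonneg_right ?_ hY0) hd
            nlinarith
    · refine (norm_sub_le_of_le_norm_sub (G := iteratedFDerivWithin ℝ k₁ (f - F) K)
        (by positivity) ((h.2 x hx).1 k₁ hk₁) ((h.2 y hy).1 k₁ hk₁) hε hθ₁ hxy).trans ?_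
      refine mul_le_mul_of_nonneg_right ?_ hd
      calc _ = 2 * (C * A * ε ^ (k + θ - k₁ : ℝ) * ε ^ (-θ₁)) := by ring
        _ = 2 * C * Y := by rw [hsplit]; ring
        _ ≤ _ := by
          refine mul_le_mul_of_nonneg_right ?_ hY0
          nlinarith

theorem ApproxBound.holderBound {k₂ : ℕ} (h : ApproxBound K k (k₂ + 1) θ (C * A) ε f F)
    (hf : HolderBound K k θ A f) (hL : HasLocalMeanValue K r₀ M)
    (hud : UniqueDiffOn ℝ K) (hM : 0 ≤ M) (hA : 0 ≤ A) (hC : 0 ≤ C) (hε : 0 < ε) (hε1 : ε ≤ 1)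
    (hεr : ε ≤ r₀) (hθ : 0 ≤ θ) {θ₂ : ℝ} (hθ₂ : 0 ≤ θ₂)
    (hθ₂1 : θ₂ < 1) (hlt : (k + θ : ℝ) < k₂ + θ₂) :
    HolderBound K k₂ θ₂ ((1 + C) * (M + 2) * (A * ε ^ (k + θ - (k₂ + θ₂) : ℝ))) F := by
  have hk₂ : k ≤ k₂ := by
    have : (k : ℝ) < (k₂ + 1 : ℕ) := by push_cast; linarith
    exact Nat.lt_succ_iff.1 (by exact_mod_cast this)
  have hFN : ∀ j ≤ k₂ + 1, ContDiff ℝ j F := fun j hj ↦ h.1.of_le (by exact_mod_cast hj)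
  set Y : ℝ := A * ε ^ (k + θ - (k₂ + θ₂) : ℝ) with hY
  have hY0 : 0 ≤ Y := by positivity
  have hAY : A ≤ Y := le_mul_of_one_le_right hA
    (Real.one_le_rpow_of_pos_of_le_one_of_nonpos hε hε1 (by linarith))
  have hCM : 0 ≤ C * M := by positivity
  have hsplit : C * A * ε ^ (k + θ - k₂ : ℝ) * ε ^ (-θ₂) = C * Y := by
    rw [hY, show (k + θ - (k₂ + θ₂) : ℝ) = (k + θ - k₂) + (-θ₂) by ring, Real.rpow_add hε]
    ring
  have hsub : ∀ j ≤ k, ∀ z ∈ K, iteratedFDerivWithin ℝ j F K z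
      = iteratedFDerivWithin ℝ j f K z - iteratedFDerivWithin ℝ j (f - F) K z := fun j hj z hz ↦ by
    rw [iteratedFDerivWithin_sub_apply (hf.1.of_le (by exact_mod_cast hj) z hz)
      (hFN j (by omega)).contDiffWithinAt hud hz, sub_sub_cancel]
  refine ⟨(hFN k₂ (by omega)).contDiffOn, fun j hj x hx ↦ ?_, fun x hx y hy ↦ ?_⟩
  · by_cases hjk : j ≤ k
    · rw [hsub j hjk x hx]
      calc _ ≤ A + C * A * ε ^ (k + θ - j : ℝ) :=
            (norm_sub_le _ _).trans (add_le_add (hf.2.1 j hjk x hx) ((h.2 x hx).1 j hjk))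
        _ ≤ A + C * A * 1 := by
          gcongr
          refine Real.rpow_le_one hε.le hε1 ?_
          have : (j : ℝ) ≤ k := by exact_mod_cast hjk
          linarith
        _ = (1 + C) * A := by ring
        _ ≤ (1 + C) * Y := by gcongr
        _ ≤ _ := by
          refine mul_le_mul_of_nonneg_right ?_ hY0
          nlinarith
    · rw [iteratedFDerivWithin_eq_iteratedFDeriv hud (hFN j (by omega)).contDiffAt hx]
      calc _ ≤ C * A * ε ^ (k + θ - j : ℝ) := (h.2 x hx).2 j (by omega) (by omega)
        _ ≤ C * A * ε ^ (k + θ - (k₂ + θ₂) : ℝ) := by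
          refine mul_le_mul_of_nonneg_left ?_ (by positivity)
          refine Real.rpow_le_rpow_of_exponent_ge hε hε1 ?_
          have : (j : ℝ) ≤ k₂ := by exact_mod_cast hj
          linarith
        _ = C * Y := by rw [hY]; ring
        _ ≤ _ := by
          refine mul_le_mul_of_nonneg_right ?_ hY0
          nlinarith
  · have hd : 0 ≤ ‖x - y‖ ^ θ₂ := by positivity
    rcases lt_or_ge ‖x - y‖ ε with hxy | hxy
    · refine (h.norm_sub_le_near hL hud hM hA hC hε hεr hk₂ le_rfl hθ₂ hθ₂1.le hx hy hxy).trans ?_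
      refine mul_le_mul_of_nonneg_right (mul_le_mul_of_nonneg_right ?_ hY0) hd
      nlinarith
    rcases hk₂.lt_or_eq with hlt' | rfl
    · have hb : ∀ z ∈ K, ‖iteratedFDerivWithin ℝ k₂ F K z‖ ≤ C * A * ε ^ (k + θ - k₂ : ℝ) :=
        fun z hz ↦ by
          rw [iteratedFDerivWithin_eq_iteratedFDeriv hud (hFN k₂ (by omega)).contDiffAt hz]
          exact (h.2 z hz).2 k₂ hlt' (by omega)
      refine (norm_sub_le_of_le_norm_sub (G := iteratedFDerivWithin ℝ k₂ F K)
        (by positivity) (hb x hx) (hb y hy) hε hθ₂ hxy).trans ?_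
      refine mul_le_mul_of_nonneg_right ?_ hd
      calc _ = 2 * (C * A * ε ^ (k + θ - k₂ : ℝ) * ε ^ (-θ₂)) := by ring
        _ = 2 * C * Y := by rw [hsplit]; ring
        _ ≤ _ := by
          refine mul_le_mul_of_nonneg_right ?_ hY0
          nlinarith
    · have h1 := norm_sub_le_of_le_norm_sub (G := iteratedFDerivWithin ℝ k (f - F) K)
        (by positivity) ((h.2 x hx).1 k le_rfl) ((h.2 y hy).1 k le_rfl) hε hθ₂ hxy
      have h2 := hf.2.2 x hx y hy
      have hθθ : θ < θ₂ := by linarith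
      have h3 := rpow_le_rpow_sub_mul_rpow_of_le hε hxy hθθ.le
      rw [hsub k le_rfl x hx, hsub k le_rfl y hy, sub_sub_sub_comm]
      calc _ ≤ A * ‖x - y‖ ^ θ
            + 2 * (C * A * ε ^ (k + θ - k : ℝ)) * ε ^ (-θ₂) * ‖x - y‖ ^ θ₂ :=
            (norm_sub_le _ _).trans (add_le_add h2 h1)
        _ = A * ‖x - y‖ ^ θ + 2 * (C * Y) * ‖x - y‖ ^ θ₂ := by rw [← hsplit]; ring
        _ ≤ A * (ε ^ (θ - θ₂) * ‖x - y‖ ^ θ₂) + 2 * (C * Y) * ‖x - y‖ ^ θ₂ := by gcongr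
        _ = (1 + 2 * C) * Y * ‖x - y‖ ^ θ₂ := by
          rw [hY, show (k + θ - (k + θ₂) : ℝ) = θ - θ₂ by ring]
          ring
        _ ≤ _ := by
          refine mul_le_mul_of_nonneg_right (mul_le_mul_of_nonneg_right ?_ hY0) hd
          nlinarith

end Interpolation

section KFunctional

variable {E : Type} [NormedAddCommGroup E] [NormedSpace ℝ E]

theorem ctNorm_nonneg (t : ℝ) (K : Set E) (f : E → ℝ) : 0 ≤ ctNorm t K f := by
  refine le_max_of_le_left (Real.sSup_nonneg ?_)
  rintro _ ⟨i, -, x, -, rfl⟩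
  exact norm_nonneg _

theorem MemCt.holderBound {t : ℝ} (ht : 0 ≤ t) {K : Set E} {f : E → ℝ} (h : MemCt t K f) :
    HolderBound K ⌊t⌋₊ (t - ⌊t⌋₊) (ctNorm t K f) f := by
  obtain ⟨hcd, ⟨C₁, hC₁⟩, C₂, hC₂⟩ := h
  refine ⟨hcd, fun j hj x hx ↦ ?_, fun x hx y hy ↦ ?_⟩
  · refine le_max_of_le_left (le_csSup ⟨C₁, ?_⟩ ⟨j, (Nat.le_floor_iff ht).1 hj, x, hx, rfl⟩)
    rintro _ ⟨i, hi, z, hz, rfl⟩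
    exact hC₁ i hi z hz
  · by_cases hxy : x = y
    · subst hxy
      simpa using mul_nonneg (ctNorm_nonneg t K f)
        (Real.rpow_nonneg (le_refl (0 : ℝ)) (t - ⌊t⌋₊))
    · have hpos : ∀ {z w : E}, z ≠ w → 0 < ‖z - w‖ ^ (t - (⌊t⌋₊ : ℝ)) := fun hzw ↦
        Real.rpow_pos_of_pos (norm_pos_iff.2 (sub_ne_zero.2 hzw)) _
      rw [← div_le_iff₀ (hpos hxy)]
      refine le_max_of_le_right (le_csSup ⟨C₂, ?_⟩ ⟨x, hx, y, hy, hxy, rfl⟩)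
      rintro _ ⟨z, hz, w, hw, hzw, rfl⟩
      rw [div_le_iff₀ (hpos hzw)]
      exact hC₂ z hz w hw

theorem HolderBound.memCt {t : ℝ} (ht : 0 ≤ t) {K : Set E} {f : E → ℝ} {A : ℝ}
    (h : HolderBound K ⌊t⌋₊ (t - ⌊t⌋₊) A f) : MemCt t K f :=
  ⟨h.1, ⟨A, fun i hi x hx ↦ h.2.1 i ((Nat.le_floor_iff ht).2 hi) x hx⟩, A, h.2.2⟩

theorem HolderBound.ctNorm_le {t : ℝ} (ht : 0 ≤ t) {K : Set E} {f : E → ℝ} {A : ℝ} (hA : 0 ≤ A)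
    (h : HolderBound K ⌊t⌋₊ (t - ⌊t⌋₊) A f) : ctNorm t K f ≤ A := by
  refine max_le (Real.sSup_le ?_ hA) (Real.sSup_le ?_ hA)
  · rintro _ ⟨i, hi, x, hx, rfl⟩
    exact h.2.1 i ((Nat.le_floor_iff ht).2 hi) x hx
  · rintro _ ⟨x, hx, y, hy, hxy, rfl⟩
    rw [div_le_iff₀ (Real.rpow_pos_of_pos (norm_pos_iff.2 (sub_ne_zero.2 hxy)) _)]
    exact h.2.2 x hx y hy

theorem kFunctional_le_of_holderBound {s t₁ t₂ A₁ A₂ : ℝ} (hs : 0 ≤ s) (ht₁ : 0 ≤ t₁)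
    (ht₂ : 0 ≤ t₂) {Ω : Set E} {f F : E → ℝ} (hf : ∀ x ∈ frontier Ω, f x = 0)
    (hF : ∀ x ∈ frontier Ω, F x = 0) (hA₁ : 0 ≤ A₁) (hA₂ : 0 ≤ A₂)
    (h₁ : HolderBound (closure Ω) ⌊t₁⌋₊ (t₁ - ⌊t₁⌋₊) A₁ (f - F))
    (h₂ : HolderBound (closure Ω) ⌊t₂⌋₊ (t₂ - ⌊t₂⌋₊) A₂ F) :
    kFunctional s t₁ t₂ Ω f ≤ A₁ + s * A₂ := by
  have hle : kFunctional s t₁ t₂ Ω f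
      ≤ ctNorm t₁ (closure Ω) (f - F) + s * ctNorm t₂ (closure Ω) F := by
    refine csInf_le ⟨0, ?_⟩ ⟨f - F, F, fun x _ ↦ by simp,
      ⟨h₁.memCt ht₁, fun x hx ↦ by simp [hf x hx, hF x hx]⟩, ⟨h₂.memCt ht₂, hF⟩, rfl⟩
    rintro _ ⟨f₀, f₁, -, -, -, rfl⟩
    exact add_nonneg (ctNorm_nonneg _ _ _) (mul_nonneg hs (ctNorm_nonneg _ _ _))
  exact hle.trans (add_le_add (h₁.ctNorm_le ht₁ hA₁)
    (mul_le_mul_of_nonneg_left (h₂.ctNorm_le ht₂ hA₂) hs))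

theorem ApproxBound.zero {K : Set E} {k N : ℕ} {θ A ε : ℝ} {f : E → ℝ} (hA : 0 ≤ A)
    (hε : 0 < ε) (hε1 : ε ≤ 1) (hf : HolderBound K k θ A f) :
    ApproxBound K k N θ (ε ^ (-(k + θ) : ℝ) * A) ε f 0 := by
  refine ⟨contDiff_zero_fun, fun x hx ↦ ⟨fun j hj ↦ ?_, fun j _ _ ↦ ?_⟩⟩
  · rw [sub_zero]
    refine (hf.2.1 j hj x hx).trans ?_
    have h1 : ε ^ (-(k + θ) : ℝ) * A * ε ^ (k + θ - j : ℝ) = A * ε ^ (-j : ℝ) := by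
      rw [show (-j : ℝ) = -(k + θ) + (k + θ - j) by ring, Real.rpow_add hε]
      ring
    rw [h1]
    exact le_mul_of_one_le_right hA
      (Real.one_le_rpow_of_pos_of_le_one_of_nonpos hε hε1 (by simp))
  · simp only [Pi.zero_def, iteratedFDeriv_fun_zero, Pi.zero_apply, norm_zero]
    positivity

theorem kFunctional_le_of_hasApprox {Ω : Set E} {t₁ t₂ α : ℝ} (ht₁ : 0 ≤ t₁) (ht : t₁ < t₂)
    (hα : α ∈ Ioo (0 : ℝ) 1) (hud : UniqueDiffOn ℝ (closure Ω)) {r₀ M : ℝ} (hr₀ : 0 < r₀)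
    (hM : 0 ≤ M) (hL : HasLocalMeanValue (closure Ω) r₀ M)
    (h : HasApprox Ω univ ⌊α * t₂ + (1 - α) * t₁⌋₊ (⌊t₂⌋₊ + 1)
      (α * t₂ + (1 - α) * t₁ - ⌊α * t₂ + (1 - α) * t₁⌋₊)) :
    ∃ C > 0, ∀ f : E → ℝ, MemCtTilde (α * t₂ + (1 - α) * t₁) Ω f → ∀ s : ℝ, 0 < s →
      s ^ (-α) * kFunctional s t₁ t₂ Ω f
        ≤ C * ctNorm (α * t₂ + (1 - α) * t₁) (closure Ω) f := by
  obtain ⟨hα0, hα1⟩ := hα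
  set t := α * t₂ + (1 - α) * t₁ with htdef
  have hd : 0 < t₂ - t₁ := sub_pos.2 ht
  have htt₁ : t - t₁ = α * (t₂ - t₁) := by rw [htdef]; ring
  have htt₂ : t - t₂ = (α - 1) * (t₂ - t₁) := by rw [htdef]; ring
  have h1t : t₁ < t := by
    have := mul_pos hα0 hd
    linarith
  have h2t : t < t₂ := by
    have := mul_pos (sub_pos.2 hα1) hd
    linarith
  have ht0 : 0 ≤ t := ht₁.trans h1t.le
  have ht₂ : 0 ≤ t₂ := ht0.trans h2t.le
  have hfl : ∀ u : ℝ, 0 ≤ u → 0 ≤ u - ⌊u⌋₊ ∧ u - ⌊u⌋₊ < 1 := fun u hu ↦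
    ⟨sub_nonneg.2 (Nat.floor_le hu), by linarith [Nat.lt_floor_add_one u]⟩
  have hkN : ⌊t⌋₊ + 1 ≤ ⌊t₂⌋₊ + 1 := Nat.succ_le_succ (Nat.floor_mono h2t.le)
  obtain ⟨C, hC, e, he, he1, H⟩ := h
  set ε₀ := min e r₀ with hε₀def
  have hε₀ : 0 < ε₀ := lt_min he hr₀
  have hε₀1 : ε₀ ≤ 1 := (min_le_left _ _).trans he1
  set C₀ := ε₀ ^ (-(⌊t⌋₊ + (t - ⌊t⌋₊)) : ℝ)
  have hC₀ : 0 ≤ C₀ := by positivity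
  refine ⟨2 * (1 + C) * (M + 2) + (1 + C₀) * (M + 2), by positivity, fun f hf s hs ↦ ?_⟩
  set A := ctNorm t (closure Ω) f
  have hA : 0 ≤ A := ctNorm_nonneg _ _ _
  have hfB := hf.1.holderBound ht0
  have hcast : ∀ u : ℝ, (⌊t⌋₊ + (t - ⌊t⌋₊) - (⌊u⌋₊ + (u - ⌊u⌋₊)) : ℝ) = t - u := fun u ↦ by ring
  suffices hmain : kFunctional s t₁ t₂ Ω f
      ≤ (2 * (1 + C) * (M + 2) + (1 + C₀) * (M + 2)) * A * s ^ α by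
    calc _ ≤ s ^ (-α) * ((2 * (1 + C) * (M + 2) + (1 + C₀) * (M + 2)) * A * s ^ α) := by gcongr
      _ = (s ^ (-α) * s ^ α) * ((2 * (1 + C) * (M + 2) + (1 + C₀) * (M + 2)) * A) := by ring
      _ = _ := by rw [← Real.rpow_add hs]; simp
  have hsA : 0 ≤ A * s ^ α := by positivity
  rcases le_or_gt s (ε₀ ^ (t₂ - t₁)) with hse | hse
  · set ε := s ^ (t₂ - t₁)⁻¹ with hεdef
    have hε : 0 < ε := Real.rpow_pos_of_pos hs _
    have hεpow : ∀ β : ℝ, ε ^ (β * (t₂ - t₁)) = s ^ β := fun β ↦ by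
      rw [hεdef, ← Real.rpow_mul hs.le]
      congr 1
      field_simp
    have hεε₀ : ε ≤ ε₀ := by
      calc ε ≤ (ε₀ ^ (t₂ - t₁)) ^ (t₂ - t₁)⁻¹ := by
            rw [hεdef]
            gcongr
        _ = ε₀ := Real.rpow_rpow_inv hε₀.le hd.ne'
    have hεr : ε ≤ r₀ := hεε₀.trans (min_le_right _ _)
    have hε1 := hεε₀.trans hε₀1
    obtain ⟨F, hF, hF0, hb⟩ := H f A ε hA hε (hεε₀.trans (min_le_left _ _)) hfB hf.2
    have hap : ApproxBound (closure Ω) ⌊t⌋₊ (⌊t₂⌋₊ + 1) (t - ⌊t⌋₊) (C * A) ε f F :=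
      ⟨contDiffOn_univ.1 hF, fun x hx ↦ hb x ⟨mem_univ x, hx⟩⟩
    have h₁ := hap.holderBound_sub (k₁ := ⌊t₁⌋₊) hfB hL hud hM hA hC hε hε1 hεr hkN (hfl t ht0).2
      (hfl t₁ ht₁).1 (hfl t₁ ht₁).2 (by linarith)
    have h₂ := hap.holderBound (k₂ := ⌊t₂⌋₊) hfB hL hud hM hA hC hε hε1 hεr (hfl t ht0).1
      (hfl t₂ ht₂).1 (hfl t₂ ht₂).2 (by linarith)
    rw [hcast, htt₁, hεpow] at h₁
    rw [hcast, htt₂, hεpow] at h₂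
    refine (kFunctional_le_of_holderBound hs.le ht₁ ht₂ hf.2 (fun x hx ↦ hF0 x ⟨mem_univ x, hx⟩)
      (by positivity) (by positivity) h₁ h₂).trans ?_
    have hs1 : s * s ^ (α - 1) = s ^ α := by
      rw [Real.rpow_sub_one hs.ne']
      field_simp
    calc _ = (1 + C) * (M + 2) * (A * s ^ α) + (1 + C) * (M + 2) * A * (s * s ^ (α - 1)) := by
          ring
      _ = 2 * (1 + C) * (M + 2) * (A * s ^ α) := by rw [hs1]; ring
      _ ≤ (2 * (1 + C) * (M + 2) + (1 + C₀) * (M + 2)) * (A * s ^ α) := by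
          refine mul_le_mul_of_nonneg_right ?_ hsA
          have : 0 ≤ (1 + C₀) * (M + 2) := by positivity
          linarith
      _ = _ := by ring
  · have hap : ApproxBound (closure Ω) ⌊t⌋₊ (⌊t₂⌋₊ + 1) (t - ⌊t⌋₊) (C₀ * A) ε₀ f 0 :=
      ApproxBound.zero hA hε₀ hε₀1 hfB
    have h₁ := hap.holderBound_sub (k₁ := ⌊t₁⌋₊) hfB hL hud hM hA hC₀ hε₀ hε₀1 (min_le_right _ _) hkN
      (hfl t ht0).2 (hfl t₁ ht₁).1 (hfl t₁ ht₁).2 (by linarith)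
    have h₂ : HolderBound (closure Ω) ⌊t₂⌋₊ (t₂ - ⌊t₂⌋₊) 0 (0 : E → ℝ) :=
      ⟨contDiffOn_const, fun j _ x _ ↦ by simp [Pi.zero_def], fun x _ y _ ↦ by
        simp [Pi.zero_def]⟩
    rw [hcast, htt₁, mul_comm α, Real.rpow_mul hε₀.le] at h₁
    refine (kFunctional_le_of_holderBound hs.le ht₁ ht₂ hf.2 (fun x hx ↦ rfl)
      (by positivity) le_rfl h₁ h₂).trans ?_
    calc _ = (1 + C₀) * (M + 2) * (A * (ε₀ ^ (t₂ - t₁)) ^ α) := by ring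
      _ ≤ (1 + C₀) * (M + 2) * (A * s ^ α) := by gcongr
      _ ≤ (2 * (1 + C) * (M + 2) + (1 + C₀) * (M + 2)) * (A * s ^ α) := by
          refine mul_le_mul_of_nonneg_right ?_ hsA
          have : 0 ≤ 2 * (1 + C) * (M + 2) := by positivity
          linarith
      _ = _ := by ring

end KFunctional

end Auxiliary

/-- For a bounded open `Ω ⊆ ℝ^m` with smooth boundary, `α ∈ (0,1)` and
`0 ≤ t₁ < t₂`, the inclusion `C̃^{α t₂ + (1-α) t₁}(cl Ω) ⊆ (C̃^{t₁}(cl Ω), C̃^{t₂}(cl Ω))_{α,∞}`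
is continuous: `sup_{s>0} s^{-α} K(s, f; C̃^{t₁}, C̃^{t₂}) ≤ C ‖f‖_{C^{α t₂ + (1-α) t₁}(cl Ω)}`. -/
theorem interpolation_inclusion_general (m : ℕ) (Ω : Set (EuclideanSpace ℝ (Fin m)))
    (hΩopen : IsOpen Ω) (hΩbdd : Bornology.IsBounded Ω) (hΩsmooth : HasSmoothBoundary Ω)
    (α : ℝ) (hα : α ∈ Ioo (0:ℝ) 1) (t₁ t₂ : ℝ) (ht₁ : 0 ≤ t₁) (ht : t₁ < t₂) :
    ∃ C > 0, ∀ f : EuclideanSpace ℝ (Fin m) → ℝ,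
      MemCtTilde (α * t₂ + (1 - α) * t₁) Ω f →
      ∀ s : ℝ, 0 < s →
        s ^ (-α) * kFunctional s t₁ t₂ Ω f
          ≤ C * ctNorm (α * t₂ + (1 - α) * t₁) (closure Ω) f := by
  have hK : IsCompact (closure Ω) := hΩbdd.isCompact_closure
  have hcone : ∀ x₀ ∈ closure Ω, ∃ ν δ r, HasConeAt Ω x₀ ν δ r := by
    intro x₀ hx₀
    by_cases hx : x₀ ∈ Ω
    · obtain ⟨r, hr⟩ := exists_hasConeAt_of_mem hΩopen hx
      exact ⟨0, 1, r, hr⟩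
    · obtain ⟨U, φ, hU, hxU, hφ, hd, h⟩ := hΩsmooth x₀ (hΩopen.frontier_eq ▸ ⟨hx₀, hx⟩)
      exact exists_hasConeAt_of_frontier hU hφ h hxU (hd x₀ hxU)
  have hud : UniqueDiffOn ℝ (closure Ω) := fun x hx ↦ by
    obtain ⟨ν, δ, r, h⟩ := hcone x hx
    exact h.uniqueDiffWithinAt hx
  obtain ⟨r₀, hr₀, M, hM, hL⟩ := exists_norm_sub_le_of_cone hK hcone
  have htlt : α * t₂ + (1 - α) * t₁ < t₂ := by nlinarith [hα.1, hα.2]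
  have ht0 : 0 ≤ α * t₂ + (1 - α) * t₁ := by nlinarith [hα.1, hα.2]
  have hkN : ⌊α * t₂ + (1 - α) * t₁⌋₊ ≤ ⌊t₂⌋₊ + 1 :=
    (Nat.floor_mono htlt.le).trans (Nat.le_succ _)
  have hθ : 0 ≤ α * t₂ + (1 - α) * t₁ - ⌊α * t₂ + (1 - α) * t₁⌋₊ :=
    sub_nonneg.2 (Nat.floor_le ht0)
  have hθ1 : α * t₂ + (1 - α) * t₁ - ⌊α * t₂ + (1 - α) * t₁⌋₊ < 1 := by
    linarith [Nat.lt_floor_add_one (α * t₂ + (1 - α) * t₁)]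
  refine kFunctional_le_of_hasApprox ht₁ ht hα hud hr₀ hM.le hL
    (hasApprox_univ hK hud hkN hθ1 fun x hx ↦ ?_)
  by_cases hxΩ : x ∈ Ω
  · exact hasApprox_of_mem hΩopen hK hud hxΩ _ _ hθ
  · have hxf : x ∈ frontier Ω := hΩopen.frontier_eq ▸ ⟨hx, hxΩ⟩
    obtain ⟨U, φ, hU, hxU, hφ, hd, h⟩ := hΩsmooth x hxf
    exact hasApprox_of_frontier hΩopen hK hud hU hφ hd h hxU hxf _ _ hkN hθ hθ1

end
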